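/- arXiv:0911.3173 — 2 statements merged into one kernel-verified Lean document; each statement's English description precedes it below -/
import Mathlib

section
/- Let 𝒜 ⊆ ℬ be two collections of subgroups of G, each closed under conjugation and under passing to subgroups, and assume that every 𝒜-tree which is universally elliptic over 𝒜 is universally elliptic over ℬ (its edge stabilizers are elliptic in every ℬ-tree). Let T_ℬ be a JSJ tree of G over ℬ, and let π : T_ℬ → T' be a collapse map whose collapsed edges are exactly the edges of T_ℬ with stabilizer not in 𝒜. Then T' is a JSJ tree of G over 𝒜. -/
universe u v

/-- A `G`-tree: a nonempty simple graph which is a tree (connected and acyclic),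
with a minimal action of `G` by graph automorphisms without inversions. -/
structure GTree (G : Type u) [Group G] : Type (u + 1) where
  V : Type u
  graph : SimpleGraph V
  nonempty : Nonempty V
  connected : graph.Connected
  acyclic : graph.IsAcyclic
  act : G → V → V
  act_one : ∀ w, act 1 w = w
  act_mul : ∀ g h w, act (g * h) w = act g (act h w)
  act_adj : ∀ g a b, graph.Adj a b → graph.Adj (act g a) (act g b)
  noInversion : ∀ g a b, graph.Adj a b → ¬(act g a = b ∧ act g b = a)
  minimal : ∀ S : Set V, S.Nonempty → (∀ g, ∀ w ∈ S, act g w ∈ S) →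
    (graph.induce S).Connected → S = Set.univ

namespace GTree

variable {G : Type u} [Group G]

/-- The stabilizer of a vertex. -/
def vertexStab (T : GTree G) (w : T.V) : Subgroup G where
  carrier := {g | T.act g w = w}
  one_mem' := T.act_one w
  mul_mem' := by
    intro a b ha hb
    simp only [Set.mem_setOf_eq] at *
    rw [T.act_mul, hb, ha]
  inv_mem' := by
    intro a ha
    simp only [Set.mem_setOf_eq] at *
    calc T.act a⁻¹ w = T.act a⁻¹ (T.act a w) := by rw [ha]
    _ = T.act (a⁻¹ * a) w := (T.act_mul _ _ _).symm
    _ = w := by rw [inv_mul_cancel, T.act_one]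

/-- The stabilizer of an edge `{u,v}`: elements fixing both endpoints. -/
def edgeStab (T : GTree G) (a b : T.V) : Subgroup G :=
  T.vertexStab a ⊓ T.vertexStab b

/-- A subgroup is elliptic in `T` if it fixes a vertex. -/
def EllipticSubgroup (T : GTree G) (H : Subgroup G) : Prop :=
  ∃ w : T.V, ∀ h ∈ H, T.act h w = w

/-- An element is elliptic in `T` if it fixes a vertex (otherwise it is hyperbolic). -/
def EllipticElt (T : GTree G) (g : G) : Prop :=
  ∃ w : T.V, T.act g w = w

/-- `T₁` dominates `T₂`: every subgroup elliptic in `T₁` is elliptic in `T₂`. -/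
def Dominates (T₁ T₂ : GTree G) : Prop :=
  ∀ H : Subgroup G, T₁.EllipticSubgroup H → T₂.EllipticSubgroup H

/-- `T` is an `𝒜`-tree: all its edge stabilizers belong to `𝒜`. -/
def IsATree (T : GTree G) (𝒜 : Set (Subgroup G)) : Prop :=
  ∀ a b : T.V, T.graph.Adj a b → T.edgeStab a b ∈ 𝒜

/-- A subgroup is universally elliptic if it is elliptic in every `𝒜`-tree. -/
def UnivEllipticSubgroup (𝒜 : Set (Subgroup G)) (H : Subgroup G) : Prop :=
  ∀ T : GTree G, T.IsATree 𝒜 → T.EllipticSubgroup H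

/-- An `𝒜`-tree is universally elliptic if all its edge stabilizers are universally elliptic. -/
def UnivEllipticTree (T : GTree G) (𝒜 : Set (Subgroup G)) : Prop :=
  ∀ a b : T.V, T.graph.Adj a b → UnivEllipticSubgroup 𝒜 (T.edgeStab a b)

/-- A JSJ tree of `G` over `𝒜`: a universally elliptic `𝒜`-tree dominating every
universally elliptic `𝒜`-tree. -/
def IsJSJ (T : GTree G) (𝒜 : Set (Subgroup G)) : Prop :=
  T.IsATree 𝒜 ∧ T.UnivEllipticTree 𝒜 ∧
    ∀ T' : GTree G, T'.IsATree 𝒜 → T'.UnivEllipticTree 𝒜 → T.Dominates T'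

/-- A collapse map `T → T'`: a `G`-equivariant surjection on vertices sending adjacent
vertices to adjacent or equal vertices, with connected point preimages. -/
def IsCollapseMap (T T' : GTree G) (f : T.V → T'.V) : Prop :=
  (∀ g w, f (T.act g w) = T'.act g (f w)) ∧
    Function.Surjective f ∧
    (∀ a b : T.V, T.graph.Adj a b → f a = f b ∨ T'.graph.Adj (f a) (f b)) ∧
    ∀ w : T'.V, (T.graph.induce (f ⁻¹' {w})).Connected

end GTree

/-- `𝒜` is closed under conjugation and under passing to subgroups. -/
def ClosedFamily {G : Type u} [Group G] (𝒜 : Set (Subgroup G)) : Prop :=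
  (∀ H ∈ 𝒜, ∀ g : G, Subgroup.map (MulAut.conj g).toMonoidHom H ∈ 𝒜) ∧
    ∀ H ∈ 𝒜, ∀ K : Subgroup G, K ≤ H → K ∈ 𝒜

/-- `G` is finitely presented: it admits a presentation with finitely many generators
and finitely many relations. -/
def FinitelyPresentedGroup (G : Type u) [Group G] : Prop :=
  ∃ (n : ℕ) (rels : Set (FreeGroup (Fin n))),
    rels.Finite ∧ Nonempty (PresentedGroup rels ≃* G)

/-- `T` is an `(𝒜,ℋ)`-tree: an `𝒜`-tree in which every subgroup in `ℋ` is elliptic. -/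
def RelATree {G : Type u} [Group G] (𝒜 ℋ : Set (Subgroup G)) (T : GTree G) : Prop :=
  T.IsATree 𝒜 ∧ ∀ H ∈ ℋ, T.EllipticSubgroup H

/-- A subgroup is universally elliptic relative to `ℋ` if it is elliptic in every
`(𝒜,ℋ)`-tree. -/
def RelUnivEllipticSubgroup {G : Type u} [Group G] (𝒜 ℋ : Set (Subgroup G))
    (K : Subgroup G) : Prop :=
  ∀ T : GTree G, RelATree 𝒜 ℋ T → T.EllipticSubgroup K

/-- An `(𝒜,ℋ)`-tree is universally elliptic if all its edge stabilizers are universally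
elliptic relative to `ℋ`. -/
def RelUnivEllipticTree {G : Type u} [Group G] (𝒜 ℋ : Set (Subgroup G))
    (T : GTree G) : Prop :=
  ∀ a b : T.V, T.graph.Adj a b → RelUnivEllipticSubgroup 𝒜 ℋ (T.edgeStab a b)

/-- A JSJ tree of `G` over `𝒜` relative to `ℋ`. -/
def IsRelJSJ {G : Type u} [Group G] (𝒜 ℋ : Set (Subgroup G)) (T : GTree G) : Prop :=
  RelATree 𝒜 ℋ T ∧ RelUnivEllipticTree 𝒜 ℋ T ∧
    ∀ T' : GTree G, RelATree 𝒜 ℋ T' → RelUnivEllipticTree 𝒜 ℋ T' → T.Dominates T'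

/-- The family of groups `F, H₁, …, H_p` whose free product is used to define relative
finite presentability. -/
def relFam {G : Type u} [Group G] {p : ℕ} (H : Fin p → Subgroup G) (n : ℕ) :
    Option (Fin p) → Type u
  | none => FreeGroup (ULift.{u} (Fin n))
  | some j => H j

instance relFamGroup {G : Type u} [Group G] {p : ℕ} (H : Fin p → Subgroup G) (n : ℕ) :
    (i : Option (Fin p)) → Group (relFam H n i)
  | none => inferInstanceAs (Group (FreeGroup _))
  | some j => inferInstanceAs (Group (H j))

/-- `G` is finitely presented relative to `H₁, …, H_p`: there is a surjection from
`F ∗ H₁ ∗ ⋯ ∗ H_p` (with `F` a finitely generated free group) onto `G` restricting to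
the inclusion on each `Hᵢ`, whose kernel is the normal closure of a finite subset. -/
def RelFinitelyPresented {G : Type u} [Group G] {p : ℕ} (H : Fin p → Subgroup G) : Prop :=
  ∃ (n : ℕ) (φ : Monoid.CoprodI (relFam H n) →* G),
    Function.Surjective φ ∧
    (∀ (j : Fin p) (h : H j), φ (Monoid.CoprodI.of (M := relFam H n) (i := some j) h) = (h : G)) ∧
    ∃ s : Set (Monoid.CoprodI (relFam H n)), s.Finite ∧
      MonoidHom.ker φ = Subgroup.normalClosure s

/-- `S` has a single orbit of edges. -/
def OneEdgeOrbit {G : Type u} [Group G] (S : GTree G) : Prop :=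
  ∀ e₁ ∈ S.graph.edgeSet, ∀ e₂ ∈ S.graph.edgeSet, ∃ g : G, Sym2.map (S.act g) e₁ = e₂

/-- `G` splits over `K`: there is a nontrivial `G`-tree with a single orbit of edges
having `K` as an edge stabilizer. -/
def SplitsOver {G : Type u} [Group G] (K : Subgroup G) : Prop :=
  ∃ S : GTree G, Nontrivial S.V ∧ OneEdgeOrbit S ∧
    ∃ x y : S.V, S.graph.Adj x y ∧ S.edgeStab x y = K

/-- A subgroup is slender if all its subgroups are finitely generated. -/
def SlenderSubgroup {G : Type u} [Group G] (H : Subgroup G) : Prop :=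
  ∀ K : Subgroup G, K ≤ H → K.FG

/-- A subgroup is abelian. -/
def AbelianSubgroup {G : Type u} [Group G] (H : Subgroup G) : Prop :=
  ∀ a ∈ H, ∀ b ∈ H, a * b = b * a

/-- `H` is malnormal in `G`: `gHg⁻¹ ∩ H ≠ {1}` implies `g ∈ H`. -/
def Malnormal {G : Type u} [Group G] (H : Subgroup G) : Prop :=
  ∀ g : G, (∃ x ∈ H, x ≠ 1 ∧ g * x * g⁻¹ ∈ H) → g ∈ H

/-- `G` is CSA: the centralizer of every nontrivial element is abelian and malnormal. -/
def IsCSA (G : Type u) [Group G] : Prop :=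
  ∀ g : G, g ≠ 1 →
    AbelianSubgroup (Subgroup.centralizer {g}) ∧ Malnormal (Subgroup.centralizer {g})

namespace GTree

variable {G : Type u} [Group G]

lemma act_injective (T : GTree G) (g : G) : Function.Injective (T.act g) := by
  intro a b hab
  have h := congrArg (T.act g⁻¹) hab
  rwa [← T.act_mul, ← T.act_mul, inv_mul_cancel, T.act_one, T.act_one] at h

/-- An element of `G` acting on a `G`-tree as a graph homomorphism. -/
def actHom (T : GTree G) (g : G) : T.graph →g T.graph where
  toFun := T.act g
  map_rel' := T.act_adj g _ _

/-- In a `G`-tree, the elements fixing two distinct vertices all fix a common edge. -/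
lemma exists_adj_inf_vertexStab_le (T : GTree G) {x y : T.V} (hxy : x ≠ y) :
    ∃ z, T.graph.Adj x z ∧ T.vertexStab x ⊓ T.vertexStab y ≤ T.edgeStab x z := by
  classical
  obtain ⟨p⟩ := T.connected.preconnected x y
  obtain ⟨p, hp⟩ := p.toPath
  refine ⟨p.getVert 1, ?_, ?_⟩
  · cases p with
    | nil => exact absurd rfl hxy
    | cons h q => simpa using h
  · intro g hg
    have hx : T.actHom g x = x := hg.1
    have hy : T.actHom g y = y := hg.2
    have hq : ((p.map (T.actHom g)).copy hx hy).IsPath := by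
      rw [SimpleGraph.Walk.isPath_copy]
      exact SimpleGraph.Walk.IsPath.map (T.act_injective g) hp
    have heq : (p.map (T.actHom g)).copy hx hy = p :=
      congrArg Subtype.val ((T.acyclic.subsingleton_path x y).elim ⟨_, hq⟩ ⟨p, hp⟩)
    refine ⟨hx, ?_⟩
    have := congrArg (fun w => w.getVert 1) heq
    rwa [SimpleGraph.Walk.getVert_copy, SimpleGraph.Walk.getVert_map] at this

/-- If `T` dominates `S`, then there is an equivariant map from the vertices of `T` to those
of `S`. -/
lemma Dominates.exists_equivariant {T S : GTree G} (h : T.Dominates S) :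
    ∃ f : T.V → S.V, ∀ g v, f (T.act g v) = S.act g (f v) := by
  choose x hx using fun v => h (T.vertexStab v) ⟨v, fun _ hg => hg⟩
  let r : Setoid T.V :=
    { r := fun v w => ∃ g, T.act g v = w
      iseqv :=
        { refl := fun v => ⟨1, T.act_one v⟩
          symm := by
            rintro v w ⟨g, rfl⟩
            exact ⟨g⁻¹, by rw [← T.act_mul, inv_mul_cancel, T.act_one]⟩
          trans := by
            rintro v w z ⟨g, rfl⟩ ⟨k, rfl⟩
            exact ⟨k * g, T.act_mul _ _ _⟩ } }
  let rep : T.V → T.V := fun v => (Quotient.mk r v).out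
  have hrep : ∀ v, ∃ g, T.act g (rep v) = v := fun v => Quotient.mk_out (s := r) v
  have hrep' : ∀ g v, rep (T.act g v) = rep v := fun g v =>
    congrArg Quotient.out (Quotient.sound (s := r) (r.symm ⟨g, rfl⟩))
  choose c hc using hrep
  refine ⟨fun v => S.act (c v) (x (rep v)), fun g v => ?_⟩
  have hmem : (g * c v)⁻¹ * c (T.act g v) ∈ T.vertexStab (rep v) := by
    change T.act _ _ = _
    have := hc (T.act g v)
    rw [hrep'] at this
    rw [T.act_mul, this]
    rw [← T.act_mul]
    calc T.act ((g * c v)⁻¹ * g) v = T.act ((g * c v)⁻¹ * g) (T.act (c v) (rep v)) := by rw [hc]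
    _ = rep v := by rw [← T.act_mul, mul_assoc, inv_mul_cancel, T.act_one]
  have := congrArg (S.act (g * c v)) (hx _ _ hmem)
  rw [← S.act_mul, mul_inv_cancel_left, S.act_mul] at this
  simpa [hrep'] using this

namespace IsCollapseMap

variable {T T' : GTree G} {f : T.V → T'.V}

/-- Every edge of the target of a collapse map lifts to an edge of the source. -/
lemma exists_adj (hf : IsCollapseMap T T' f) {p q : T'.V} (hpq : T'.graph.Adj p q) :
    ∃ a b, T.graph.Adj a b ∧ f a = p ∧ f b = q := by
  obtain ⟨-, hsurj, hadj, -⟩ := hf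
  obtain ⟨a, ha⟩ := hsurj p
  obtain ⟨b, hb⟩ := hsurj q
  have hbr := SimpleGraph.isAcyclic_iff_forall_adj_isBridge.1 T'.acyclic hpq
  rw [SimpleGraph.isBridge_iff] at hbr
  set D := T'.graph.deleteEdges {s(p, q)} with hD
  obtain ⟨w⟩ := T.connected.preconnected a b
  obtain ⟨d, -, h1, h2⟩ := w.exists_boundary_dart {v | D.Reachable p (f v)}
    (by simp [ha]) (by simpa [hb] using hbr)
  have hne : f d.fst ≠ f d.snd := by
    intro h
    simp only [Set.mem_ofPred_eq] at h1 h2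
    exact h2 (h ▸ h1)
  have hd := (hadj _ _ d.adj).resolve_left hne
  have hedge : s(f d.fst, f d.snd) = s(p, q) := by
    by_contra hcon
    refine h2 (SimpleGraph.Reachable.trans h1 (SimpleGraph.Adj.reachable ?_))
    simp [hD, hd, hcon]
  rcases Sym2.eq_iff.1 hedge with ⟨h3, h4⟩ | ⟨h3, h4⟩
  · exact ⟨_, _, d.adj, h3, h4⟩
  · exact absurd (h4 ▸ SimpleGraph.Reachable.refl p) h2

/-- The lift of an edge under a collapse map is unique. -/
lemma adj_unique (hf : IsCollapseMap T T' f) {a b a' b' : T.V} (hab : T.graph.Adj a b)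
    (hab' : T.graph.Adj a' b') (ha : f a' = f a) (hb : f b' = f b) (hne : f a ≠ f b) :
    a' = a ∧ b' = b := by
  have hbr := SimpleGraph.isAcyclic_iff_forall_adj_isBridge.1 T.acyclic hab
  rw [SimpleGraph.isBridge_iff] at hbr
  set D := T.graph.deleteEdges {s(a, b)}
  have hfib : ∀ x y, f x = f y → D.Reachable x y := by
    intro x y hxy
    let φ : T.graph.induce (f ⁻¹' {f y}) →g D :=
      { toFun := Subtype.val
        map_rel' := by
          rintro ⟨u, hu⟩ ⟨v, hv⟩ huv
          have huv' : T.graph.Adj u v := huv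
          simp only [Set.mem_preimage, Set.mem_singleton_iff] at hu hv
          have : s(u, v) ≠ s(a, b) := by
            intro h
            rcases Sym2.eq_iff.1 h with ⟨rfl, rfl⟩ | ⟨rfl, rfl⟩
            · exact hne (hu.trans hv.symm)
            · exact hne (hv.trans hu.symm)
          exact SimpleGraph.deleteEdges_adj.2 ⟨huv', this⟩ }
    exact ((hf.2.2.2 (f y)).preconnected ⟨x, hxy⟩ ⟨y, rfl⟩).map φ
  by_contra hcon
  refine hbr ((hfib a a' ha.symm).trans (SimpleGraph.Reachable.trans
    (SimpleGraph.Adj.reachable ?_) (hfib b' b hb)))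
  refine SimpleGraph.deleteEdges_adj.2 ⟨hab', fun h => ?_⟩
  rcases Sym2.eq_iff.1 h with h | ⟨rfl, rfl⟩
  · exact hcon h
  · exact hne ha.symm

/-- A collapse map preserves the stabilizers of the edges that it does not collapse. -/
lemma edgeStab_eq (hf : IsCollapseMap T T' f) {a b : T.V} (hab : T.graph.Adj a b)
    (hne : f a ≠ f b) : T'.edgeStab (f a) (f b) = T.edgeStab a b := by
  ext g
  constructor
  · rintro ⟨h1, h2⟩
    exact hf.adj_unique hab (T.act_adj g _ _ hab) ((hf.1 g a).trans h1) ((hf.1 g b).trans h2) hne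
  · rintro ⟨h1, h2⟩
    exact ⟨(hf.1 g a).symm.trans (congrArg f h1), (hf.1 g b).symm.trans (congrArg f h2)⟩

/-- Every edge stabilizer of the target of a collapse map is the stabilizer of an edge of the
source that is not collapsed. -/
lemma exists_edgeStab_eq (hf : IsCollapseMap T T' f) {p q : T'.V} (hpq : T'.graph.Adj p q) :
    ∃ a b, T.graph.Adj a b ∧ f a ≠ f b ∧ T'.edgeStab p q = T.edgeStab a b := by
  obtain ⟨a, b, hab, rfl, rfl⟩ := hf.exists_adj hpq
  exact ⟨a, b, hab, hpq.ne, hf.edgeStab_eq hab hpq.ne⟩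

/-- If `T` dominates an `𝒜`-tree `S`, then so does any tree obtained from `T` by collapsing
only edges with stabilizer not in `𝒜`. -/
lemma dominates (hf : IsCollapseMap T T' f) {𝒜 : Set (Subgroup G)}
    (h𝒜 : ∀ H ∈ 𝒜, ∀ K ≤ H, K ∈ 𝒜)
    (hcoll : ∀ a b, T.graph.Adj a b → f a = f b → T.edgeStab a b ∉ 𝒜)
    {S : GTree G} (hS : S.IsATree 𝒜) (hTS : T.Dominates S) : T'.Dominates S := by
  obtain ⟨φ, hφ⟩ := hTS.exists_equivariant
  have hadj : ∀ a b, T.graph.Adj a b → f a = f b → φ a = φ b := by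
    intro a b hab hfab
    by_contra hne
    obtain ⟨z, hz, hle⟩ := S.exists_adj_inf_vertexStab_le hne
    refine hcoll a b hab hfab (h𝒜 _ (hS _ _ hz) _ (le_trans ?_ hle))
    rintro g ⟨h1, h2⟩
    exact ⟨(hφ g a).symm.trans (congrArg φ h1), (hφ g b).symm.trans (congrArg φ h2)⟩
  have hfib : ∀ a b, f a = f b → φ a = φ b := by
    intro a b hab
    obtain ⟨w⟩ := (hf.2.2.2 (f b)).preconnected ⟨a, hab⟩ ⟨b, rfl⟩
    have key : ∀ u v : f ⁻¹' {f b}, (T.graph.induce (f ⁻¹' {f b})).Walk u v →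
        φ u = φ v := by
      intro u v w
      induction w with
      | nil => rfl
      | @cons u v _ h _ ih => exact (hadj u v h (u.2.trans v.2.symm)).trans ih
    exact key _ _ w
  rintro H ⟨w, hw⟩
  obtain ⟨v, rfl⟩ := hf.2.1 w
  exact ⟨φ v, fun g hg => by rw [← hφ]; exact hfib _ _ ((hf.1 g v).trans (hw g hg))⟩

end IsCollapseMap

lemma IsATree.mono {T : GTree G} {𝒜 ℬ : Set (Subgroup G)} (h : T.IsATree 𝒜) (hsub : 𝒜 ⊆ ℬ) :
    T.IsATree ℬ :=
  fun a b hab => hsub (h a b hab)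

lemma UnivEllipticSubgroup.anti {𝒜 ℬ : Set (Subgroup G)} {H : Subgroup G}
    (h : UnivEllipticSubgroup ℬ H) (hsub : 𝒜 ⊆ ℬ) : UnivEllipticSubgroup 𝒜 H :=
  fun T hT => h T (hT.mono hsub)

end GTree

/-- if every `𝒜`-universally elliptic `𝒜`-tree is `ℬ`-universally
elliptic, collapsing the edges of a JSJ tree over `ℬ` with stabilizer not in `𝒜`
yields a JSJ tree over `𝒜`. -/
theorem jsj_from_collapse {G : Type u} [Group G] (hfg : Group.FG G)
    (𝒜 ℬ : Set (Subgroup G)) (h𝒜 : ClosedFamily 𝒜) (hℬ : ClosedFamily ℬ)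
    (hsub : 𝒜 ⊆ ℬ)
    (hcomp : ∀ T : GTree G, T.IsATree 𝒜 → T.UnivEllipticTree 𝒜 → T.UnivEllipticTree ℬ)
    (Tb : GTree G) (hTb : Tb.IsJSJ ℬ)
    (T' : GTree G) (π : Tb.V → T'.V) (hπ : GTree.IsCollapseMap Tb T' π)
    (hcoll : ∀ a b : Tb.V, Tb.graph.Adj a b → (π a = π b ↔ Tb.edgeStab a b ∉ 𝒜)) :
    T'.IsJSJ 𝒜 := by
  obtain ⟨-, hue, hdom⟩ := hTb
  refine ⟨fun p q hpq => ?_, fun p q hpq => ?_, fun S hS hSue => ?_⟩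
  · obtain ⟨a, b, hab, hne, heq⟩ := hπ.exists_edgeStab_eq hpq
    rw [heq]
    exact not_not.1 fun h => hne ((hcoll a b hab).2 h)
  · obtain ⟨a, b, hab, -, heq⟩ := hπ.exists_edgeStab_eq hpq
    rw [heq]
    exact (hue a b hab).anti hsub
  · exact hπ.dominates h𝒜.2 (fun a b hab => (hcoll a b hab).1) hS
      (hdom S (hS.mono hsub) (hcomp S hS hSue))
end

section
/- Let G be finitely presented, and let (T_k)_{k≥1} be a sequence of 𝒜-trees together with a collapse map T_{k+1} → T_k for each k. Then there exist an 𝒜-tree S, all of whose edge stabilizers and vertex stabilizers are finitely generated, and an index k₀, such that for every k ≥ k₀ there is a G-equivariant map f_k from the vertices of S to the vertices of T_k with f_k(u) ≠ f_k(v) for every edge {u,v} of S; in particular, S dominates T_k for every k ≥ k₀. -/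
universe u v

/-! ### Separation in trees -/

namespace TreeSep

variable {V : Type*} {Γ : SimpleGraph V}

/-- The vertex `v` lies on every walk from `x` to `y`. -/
def OnSeg (Γ : SimpleGraph V) (v x y : V) : Prop :=
  ∀ p : Γ.Walk x y, v ∈ p.support

/-- The vertex `w` can be reached from `a` without crossing the edge `{a, b}`. -/
def Side (Γ : SimpleGraph V) (a b w : V) : Prop :=
  (Γ.deleteEdges {s(a, b)}).Reachable a w

/-- The vertices `x` and `y` lie on different sides of the edge `{a, b}`. -/
def Sep (Γ : SimpleGraph V) (a b x y : V) : Prop :=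
  ¬(Side Γ a b x ↔ Side Γ a b y)

theorem onSeg_left (x y : V) : OnSeg Γ x x y := fun p => p.start_mem_support

theorem onSeg_right (x y : V) : OnSeg Γ y x y := fun p => p.end_mem_support

theorem OnSeg.symm {v x y : V} (h : OnSeg Γ v x y) : OnSeg Γ v y x := fun p => by
  simpa using h p.reverse

theorem OnSeg.or (z : V) {v x y : V} (h : OnSeg Γ v x y) : OnSeg Γ v x z ∨ OnSeg Γ v z y := by
  by_contra! hc
  simp only [OnSeg, not_forall] at hc
  obtain ⟨⟨p, hp⟩, q, hq⟩ := hc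
  have := h (p.append q)
  rw [SimpleGraph.Walk.mem_support_append_iff] at this
  tauto

theorem Sep.symm {a b x y : V} (h : Sep Γ a b x y) : Sep Γ a b y x := fun h' => h h'.symm

theorem not_sep_self (a b x : V) : ¬Sep Γ a b x x := fun h => h Iff.rfl

/-- A walk between two points at which `h` takes different values crosses an edge at whose
endpoints `h` takes different values. -/
theorem exists_step (h : V → Prop) {x y : V} (p : Γ.Walk x y) (hne : ¬(h x ↔ h y)) :
    ∃ u w, Γ.Adj u w ∧ s(u, w) ∈ p.edges ∧ ¬(h u ↔ h w) := by
  induction p with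
  | nil => exact absurd Iff.rfl hne
  | @cons u v w huv p ih =>
    by_cases h1 : h u ↔ h v
    · obtain ⟨a, b, hab, hm, hn⟩ := ih (by tauto)
      exact ⟨a, b, hab, by simp [hm], hn⟩
    · exact ⟨u, v, huv, by simp, h1⟩

theorem side_iff_of_adj {a b u w : V} (h : Γ.Adj u w) (hne : s(u, w) ≠ s(a, b)) :
    Side Γ a b u ↔ Side Γ a b w := by
  have : (Γ.deleteEdges {s(a, b)}).Adj u w := by
    rw [SimpleGraph.deleteEdges_adj]
    exact ⟨h, by simpa using hne⟩
  exact ⟨fun h => h.trans this.reachable, fun h => h.trans this.symm.reachable⟩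

theorem side_left (a b : V) : Side Γ a b a := SimpleGraph.Reachable.refl _

theorem not_side_right (hΓ : Γ.IsAcyclic) {a b : V} (h : Γ.Adj a b) : ¬Side Γ a b b := by
  have := SimpleGraph.isAcyclic_iff_forall_adj_isBridge.1 hΓ h
  rw [SimpleGraph.isBridge_iff] at this
  exact this

theorem sep_self (hΓ : Γ.IsAcyclic) {a b : V} (h : Γ.Adj a b) : Sep Γ a b a b := fun h' =>
  not_side_right hΓ h (h'.1 (side_left a b))

theorem sep_iff_of_adj (hΓ : Γ.IsAcyclic) {a b c d : V} (h : Γ.Adj a b) (hcd : Γ.Adj c d) :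
    Sep Γ a b c d ↔ s(c, d) = s(a, b) := by
  constructor
  · intro hs
    by_contra hne
    exact hs (side_iff_of_adj hcd hne)
  · intro he
    rcases Sym2.eq_iff.1 he with ⟨rfl, rfl⟩ | ⟨rfl, rfl⟩
    · exact sep_self hΓ h
    · exact (sep_self hΓ h).symm

theorem Sep.mem_edges {a b x y : V} (h : Sep Γ a b x y) (p : Γ.Walk x y) :
    s(a, b) ∈ p.edges := by
  obtain ⟨u, w, huw, hm, hn⟩ := exists_step (Side Γ a b) p h
  have : s(u, w) = s(a, b) := by
    by_contra hne
    exact hn (side_iff_of_adj huw hne)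
  rwa [← this]

theorem Sep.onSeg_left {a b x y : V} (h : Sep Γ a b x y) : OnSeg Γ a x y := fun p =>
  p.fst_mem_support_of_mem_edges (h.mem_edges p)

theorem Sep.onSeg_right {a b x y : V} (h : Sep Γ a b x y) : OnSeg Γ b x y := fun p =>
  p.snd_mem_support_of_mem_edges (h.mem_edges p)

/-- Two predicates changing along the same edges separate the same pairs of vertices. -/
theorem iff_congr_of_adj {h h' : V → Prop} (hc : Γ.Connected)
    (H : ∀ u w, Γ.Adj u w → ((h u ↔ h w) ↔ (h' u ↔ h' w))) (x y : V) :
    (h x ↔ h y) ↔ (h' x ↔ h' y) := by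
  obtain ⟨p⟩ := hc.preconnected x y
  induction p with
  | nil => tauto
  | cons huv p ih =>
    have := H _ _ huv
    tauto

theorem sep_comm (hΓ : Γ.IsTree) {a b : V} (h : Γ.Adj a b) (x y : V) :
    Sep Γ a b x y ↔ Sep Γ b a x y := by
  refine not_congr (iff_congr_of_adj hΓ.1 (fun u w huw => not_iff_not.1 ?_) x y)
  rw [← Sep, ← Sep, sep_iff_of_adj hΓ.2 h huw, sep_iff_of_adj hΓ.2 h.symm huw,
    Sym2.eq_swap (a := a)]

theorem side_or (hc : Γ.Connected) (a b w : V) : Side Γ a b w ∨ Side Γ b a w := by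
  obtain ⟨p⟩ := hc.preconnected a w
  suffices ∀ {u w : V} (p : Γ.Walk u w), Side Γ a b u ∨ Side Γ b a u →
      Side Γ a b w ∨ Side Γ b a w from this p (Or.inl (side_left a b))
  intro u w p
  induction p with
  | nil => exact id
  | @cons u v w huv p ih =>
    intro hu
    apply ih
    by_cases he : s(u, v) = s(a, b)
    · rcases Sym2.eq_iff.1 he with ⟨rfl, rfl⟩ | ⟨rfl, rfl⟩
      · exact Or.inr (side_left _ _)
      · exact Or.inl (side_left _ _)
    · rw [← side_iff_of_adj huv he, ← side_iff_of_adj huv (by rwa [Sym2.eq_swap (a := b)])]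
      exact hu

/-- If `v` lies between `x` and `y`, an edge separating `x` from `v` separates `x` from `y`. -/
theorem OnSeg.sep (hΓ : Γ.IsTree) {a b v x y : V} (hab : Γ.Adj a b) (hv : OnSeg Γ v x y)
    (h : Sep Γ a b x v) : Sep Γ a b x y := by
  intro hxy
  have key : ∀ c d, Γ.Adj c d → Sep Γ c d x v → Side Γ c d x → Side Γ c d y → False := by
    intro c d hcd hs hx hy
    obtain ⟨p⟩ : (Γ.deleteEdges {s(c, d)}).Reachable x y := hx.symm.trans hy
    have hm := hv (p.mapLe (Γ.deleteEdges_le _))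
    rw [SimpleGraph.Walk.support_mapLe_eq_support] at hm
    classical
    exact hs ⟨fun h => h.trans ⟨p.takeUntil v hm⟩, fun _ => hx⟩
  by_cases hx : Side Γ a b x
  · exact key a b hab h hx (hxy.1 hx)
  · exact key b a hab.symm ((sep_comm hΓ hab _ _).1 h) ((side_or hΓ.1 a b x).resolve_left hx)
      ((side_or hΓ.1 a b y).resolve_left (fun h => hx (hxy.2 h)))

/-- In a forest, the edges of a path separate its endpoints. -/
theorem sep_of_mem_edges_of_isPath (hΓ : Γ.IsAcyclic) {x y : V} (p : Γ.Walk x y) (hp : p.IsPath)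
    {a b : V} (h : s(a, b) ∈ p.edges) : Sep Γ a b x y := by
  induction p with
  | nil => simp at h
  | @cons u v w huv p ih =>
    rw [SimpleGraph.Walk.cons_isPath_iff] at hp
    rw [SimpleGraph.Walk.edges_cons, List.mem_cons] at h
    have hab : Γ.Adj a b := by
      rcases h with h | h
      · rcases Sym2.eq_iff.1 h with ⟨rfl, rfl⟩ | ⟨rfl, rfl⟩
        exacts [huv, huv.symm]
      · exact p.adj_of_mem_edges h
    by_cases hm : s(a, b) ∈ p.edges
    · have h1 := ih hp.1 hm
      have h2 : Side Γ a b u ↔ Side Γ a b v := by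
        refine side_iff_of_adj huv fun he => hp.2 ?_
        rw [← he] at hm
        exact p.fst_mem_support_of_mem_edges hm
      rw [Sep] at h1 ⊢
      tauto
    · have h1 : ¬Sep Γ a b v w := fun h' => hm (h'.mem_edges p)
      have h2 := (sep_iff_of_adj hΓ hab huv).2 (h.resolve_right hm).symm
      rw [Sep] at h1 h2 ⊢
      tauto

theorem exists_walk_sep (hΓ : Γ.IsTree) (x y : V) :
    ∃ p : Γ.Walk x y, p.length = Γ.dist x y ∧ p.edges.Nodup ∧
      ∀ a b, s(a, b) ∈ p.edges → Sep Γ a b x y := by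
  obtain ⟨p, hp, hl⟩ := hΓ.1.exists_path_of_dist x y
  exact ⟨p, hl, hp.isTrail.edges_nodup,
    fun a b h => sep_of_mem_edges_of_isPath hΓ.2 p hp h⟩

theorem OnSeg.dist_add (hc : Γ.Connected) {v x y : V} (h : OnSeg Γ v x y) :
    Γ.dist x v + Γ.dist v y = Γ.dist x y := by
  classical
  obtain ⟨p, hp⟩ := hc.exists_walk_length_eq_dist x y
  have hm := h p
  have h1 := SimpleGraph.dist_le (p.takeUntil v hm)
  have h2 := SimpleGraph.dist_le (p.dropUntil v hm)
  have h3 := congrArg SimpleGraph.Walk.length (p.take_spec hm)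
  rw [SimpleGraph.Walk.length_append] at h3
  have h4 := hc.dist_triangle (u := x) (v := v) (w := y)
  omega

theorem finite_onSeg (hc : Γ.Connected) (x y : V) : {v | OnSeg Γ v x y}.Finite := by
  obtain ⟨p⟩ := hc.preconnected x y
  exact p.support.finite_toSet.subset fun v hv => hv p

theorem finite_sep (hc : Γ.Connected) (x y : V) : {e : V × V | Sep Γ e.1 e.2 x y}.Finite := by
  refine ((finite_onSeg hc x y).prod (finite_onSeg hc x y)).subset fun e he => ?_
  exact ⟨Sep.onSeg_left he, Sep.onSeg_right he⟩

/-- The sum of the distances from `x` to the endpoints of an edge; it orders the edges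
separating `x` from another vertex. -/
noncomputable def depth (Γ : SimpleGraph V) (x : V) (e : V × V) : ℕ :=
  Γ.dist x e.1 + Γ.dist x e.2

theorem depth_add_depth (hc : Γ.Connected) {x y : V} {e : V × V} (h : Sep Γ e.1 e.2 x y) :
    depth Γ x e + depth Γ y e = 2 * Γ.dist x y := by
  have h1 := h.onSeg_left.dist_add hc
  have h2 := h.onSeg_right.dist_add hc
  rw [Γ.dist_comm] at h1 h2
  simp only [depth]
  rw [Γ.dist_comm (u := y), Γ.dist_comm (u := y), Γ.dist_comm (u := x),
      Γ.dist_comm (u := x) (v := e.2)]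
  omega

theorem depth_lt_of_sep (hΓ : Γ.IsTree) {x : V} {e e' : V × V} (he : Γ.Adj e.1 e.2)
    (h1 : Sep Γ e.1 e.2 x e'.1) (h2 : Sep Γ e.1 e.2 x e'.2) : depth Γ x e < depth Γ x e' := by
  have a1 := h1.onSeg_left.dist_add hΓ.1
  have a2 := h1.onSeg_right.dist_add hΓ.1
  have a3 := h2.onSeg_left.dist_add hΓ.1
  have a4 := h2.onSeg_right.dist_add hΓ.1
  have hne : e.1 ≠ e.2 := he.ne
  simp only [depth]
  by_contra hlt
  have z1 : Γ.dist e.1 e'.1 = 0 := by omega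
  have z2 : Γ.dist e.2 e'.1 = 0 := by omega
  rw [hΓ.1.dist_eq_zero_iff] at z1 z2
  exact hne (z1.trans z2.symm)

theorem sep_or_depth_lt (hΓ : Γ.IsTree) {x y : V} {e e' : V × V} (he : Γ.Adj e.1 e.2)
    (he' : Γ.Adj e'.1 e'.2) (hne : s(e.1, e.2) ≠ s(e'.1, e'.2)) (h : Sep Γ e.1 e.2 x y)
    (h' : Sep Γ e'.1 e'.2 x y) :
    Sep Γ e.1 e.2 x e'.1 ∧ depth Γ x e < depth Γ x e' ∨ depth Γ x e' < depth Γ x e := by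
  have hs : Side Γ e.1 e.2 e'.1 ↔ Side Γ e.1 e.2 e'.2 := side_iff_of_adj he' hne.symm
  by_cases h1 : Sep Γ e.1 e.2 x e'.1
  · exact Or.inl ⟨h1, depth_lt_of_sep hΓ he h1 (by rw [Sep] at h1 ⊢; tauto)⟩
  · right
    have := depth_lt_of_sep hΓ (x := y) (e' := e') he (by rw [Sep] at *; tauto)
      (by rw [Sep] at *; tauto)
    have := depth_add_depth hΓ.1 h
    have := depth_add_depth hΓ.1 h'
    omega

theorem depth_injOn (hΓ : Γ.IsTree) {x y : V} {e e' : V × V} (he : Γ.Adj e.1 e.2)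
    (he' : Γ.Adj e'.1 e'.2) (h : Sep Γ e.1 e.2 x y) (h' : Sep Γ e'.1 e'.2 x y)
    (hd : depth Γ x e = depth Γ x e') : s(e.1, e.2) = s(e'.1, e'.2) := by
  by_contra hne
  rcases sep_or_depth_lt hΓ he he' hne h h' with h | h
  · omega
  · omega

/-- Edges separating `x` from `y` which come before an edge separating `x` from both `y`
and `z` also separate `x` from `z`. -/
theorem sep_of_depth_lt (hΓ : Γ.IsTree) {x y z : V} {e e' : V × V} (he : Γ.Adj e.1 e.2)
    (he' : Γ.Adj e'.1 e'.2) (h : Sep Γ e.1 e.2 x y) (h' : Sep Γ e'.1 e'.2 x y)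
    (hz : Sep Γ e'.1 e'.2 x z) (hd : depth Γ x e < depth Γ x e') : Sep Γ e.1 e.2 x z := by
  by_cases hne : s(e.1, e.2) = s(e'.1, e'.2)
  · rcases Sym2.eq_iff.1 hne with ⟨h1, h2⟩ | ⟨h1, h2⟩
    · rwa [h1, h2]
    · rwa [h1, h2, sep_comm hΓ he'.symm]
  · rcases sep_or_depth_lt hΓ he he' hne h h' with h | h
    · exact hz.onSeg_left.sep hΓ he h.1
    · omega

end TreeSep

/-! ### Complexes with trivial first cohomology -/

/-- Two elements of `G` are joined by an edge of the complex defined by `B`. -/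
def BAdj {G : Type*} [Group G] (B : Set G) (x y : G) : Prop := x⁻¹ * y ∈ B

/-- A finite symmetric generating set such that the associated flag complex with vertex set `G`
has trivial first cohomology modulo two. -/
structure IsCoclosed {G : Type*} [Group G] (B : Set G) : Prop where
  finite : B.Finite
  one_mem : 1 ∈ B
  inv_mem : ∀ b ∈ B, b⁻¹ ∈ B
  closure_eq : Subgroup.closure B = ⊤
  exists_primitive : ∀ t : G → G → Prop,
    (∀ x y z, BAdj B x y → BAdj B y z → BAdj B x z → (t x z ↔ Xor (t x y) (t y z))) →
    ∃ A : G → Prop, ∀ x y, BAdj B x y → (t x y ↔ Xor (A x) (A y))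

namespace IsCoclosed

variable {G : Type*} [Group G] {B : Set G}

theorem refl (hB : IsCoclosed B) (x : G) : BAdj B x x := by
  simpa [BAdj] using hB.one_mem

theorem symm (hB : IsCoclosed B) {x y : G} (h : BAdj B x y) : BAdj B y x := by
  have := hB.inv_mem _ h
  simpa [BAdj] using this

theorem induction (hB : IsCoclosed B) {P : G → Prop} (x : G) (hx : P x)
    (h : ∀ y z, BAdj B y z → P y → P z) (y : G) : P y := by
  have : ∀ g ∈ Subgroup.closure B, P (x * g) := by
    intro g hg
    induction hg using Subgroup.closure_induction_right with
    | one => simpa using hx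
    | mul_right g _ b hb ih => exact h _ _ (by simpa [BAdj, mul_assoc] using hb) ih
    | mul_inv_cancel g _ b hb ih =>
      exact h _ _ (by simpa [BAdj, mul_assoc] using hB.inv_mem b hb) ih
  simpa using this (x⁻¹ * y) (by simp [hB.closure_eq])

end IsCoclosed

theorem BAdj.smul {G : Type*} [Group G] {B : Set G} {x y : G} (h : BAdj B x y) (g : G) :
    BAdj B (g * x) (g * y) := by
  simpa [BAdj, mul_assoc] using h

section Presentation

variable {G : Type*} [Group G] {n : ℕ}

/-- The images of the words of length at most `N`. -/
def wordBall (ev : FreeGroup (Fin n) →* G) (N : ℕ) : Set G :=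
  {g | ∃ l : List (Fin n × Bool), l.length ≤ N ∧ ev (FreeGroup.mk l) = g}

theorem wordBall_finite (ev : FreeGroup (Fin n) →* G) (N : ℕ) : (wordBall ev N).Finite := by
  refine ((List.finite_length_le (Fin n × Bool) N).image fun l => ev (FreeGroup.mk l)).subset ?_
  rintro g ⟨l, hl, rfl⟩
  exact ⟨l, hl, rfl⟩

theorem mem_wordBall_inv {ev : FreeGroup (Fin n) →* G} {N : ℕ} {g : G} (hg : g ∈ wordBall ev N) :
    g⁻¹ ∈ wordBall ev N := by
  obtain ⟨l, hl, rfl⟩ := hg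
  exact ⟨FreeGroup.invRev l, by simpa using hl, by rw [← FreeGroup.inv_mk, map_inv]⟩

/-- The permutation of `G × Bool` lifting right translation by `a⁻¹` and twisted by `t`. -/
noncomputable def twistPerm (t : G → G → Bool) (ht : ∀ x y, t x y = t y x) (a : G) :
    Equiv.Perm (G × Bool) where
  toFun p := (p.1 * a⁻¹, p.2 ^^ t p.1 (p.1 * a⁻¹))
  invFun p := (p.1 * a, p.2 ^^ t p.1 (p.1 * a))
  left_inv p := by ext <;> simp [ht p.1]
  right_inv p := by ext <;> simp [ht p.1]

theorem lift_twistPerm (ev : FreeGroup (Fin n) →* G) {N : ℕ} (hN : 1 ≤ N) (t : G → G → Bool)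
    (ht : ∀ x y, t x y = t y x)
    (hc : ∀ x y z, BAdj (wordBall ev N) x y → BAdj (wordBall ev N) y z →
      BAdj (wordBall ev N) x z → t x z = (t x y ^^ t y z))
    (l : List (Fin n × Bool)) (hl : l.length ≤ N) (g : G) (s : Bool) :
    FreeGroup.lift (fun i => twistPerm t ht (ev (FreeGroup.of i))) (FreeGroup.mk l) (g, s) =
      (g * (ev (FreeGroup.mk l))⁻¹, s ^^ t g (g * (ev (FreeGroup.mk l))⁻¹)) := by
  induction l with
  | nil =>
    have h1 : BAdj (wordBall ev N) g g := ⟨[], by simp, by simp [← FreeGroup.one_eq_mk]⟩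
    have := hc g g g h1 h1 h1
    simp at this
    simp [← FreeGroup.one_eq_mk, this]
  | cons p l ih =>
    obtain ⟨i, b⟩ := p
    have hl' : l.length ≤ N := by simp at hl; omega
    have hmk : FreeGroup.mk ((i, b) :: l) = FreeGroup.mk [(i, b)] * FreeGroup.mk l := by
      simp
    have h1 : BAdj (wordBall ev N) g (g * (ev (FreeGroup.mk l))⁻¹) := by
      simpa [BAdj] using mem_wordBall_inv ⟨l, hl', rfl⟩
    have h2 : BAdj (wordBall ev N) g (g * (ev (FreeGroup.mk ((i, b) :: l)))⁻¹) := by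
      simpa [BAdj] using mem_wordBall_inv ⟨_, hl, rfl⟩
    have h3 : BAdj (wordBall ev N) (g * (ev (FreeGroup.mk l))⁻¹)
        (g * (ev (FreeGroup.mk ((i, b) :: l)))⁻¹) := by
      have : (g * (ev (FreeGroup.mk l))⁻¹)⁻¹ * (g * (ev (FreeGroup.mk ((i, b) :: l)))⁻¹) =
        (ev (FreeGroup.mk [(i, b)]))⁻¹ := by rw [hmk, map_mul]; group
      rw [BAdj, this]
      exact mem_wordBall_inv ⟨[(i, b)], by simpa using hN, rfl⟩
    rw [hc _ _ _ h1 h3 h2, hmk, map_mul, Equiv.Perm.mul_apply, ih hl', map_mul]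
    cases b
    · have hb : FreeGroup.mk [(i, false)] = (FreeGroup.of i)⁻¹ := rfl
      rw [hb, map_inv, FreeGroup.lift_apply_of, Equiv.Perm.inv_def]
      simp [twistPerm, mul_assoc]
    · have hb : FreeGroup.mk [(i, true)] = FreeGroup.of i := rfl
      rw [hb, FreeGroup.lift_apply_of]
      simp [twistPerm, mul_assoc]

theorem isCoclosed_wordBall (rels : Set (FreeGroup (Fin n))) (φ : PresentedGroup rels ≃* G)
    {N : ℕ} (hN : 1 ≤ N) (hr : ∀ r ∈ rels, r.toWord.length ≤ N) :
    IsCoclosed (wordBall (φ.toMonoidHom.comp (PresentedGroup.mk rels)) N) := by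
  set ev := φ.toMonoidHom.comp (PresentedGroup.mk rels) with hev
  have hsurj : Function.Surjective ev := φ.surjective.comp (PresentedGroup.mk_surjective rels)
  refine ⟨wordBall_finite ev N, ⟨[], by simp, by simp [← FreeGroup.one_eq_mk]⟩,
    fun _ => mem_wordBall_inv, ?_, fun t hc => ?_⟩
  · rw [eq_top_iff]
    intro g _
    obtain ⟨w, rfl⟩ := hsurj g
    induction w using FreeGroup.induction_on with
    | C1 => simp
    | of i => exact Subgroup.subset_closure ⟨[(i, true)], by simpa using hN, rfl⟩
    | inv_of i h => rw [map_inv]; exact inv_mem (h trivial)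
    | mul x y hx hy => rw [map_mul]; exact mul_mem (hx trivial) (hy trivial)
  · classical
    have hrefl : ∀ x, BAdj (wordBall ev N) x x := fun x =>
      ⟨[], by simp, by simp [← FreeGroup.one_eq_mk]⟩
    have hsymm : ∀ x y, BAdj (wordBall ev N) x y → BAdj (wordBall ev N) y x := fun x y h => by
      have := mem_wordBall_inv h
      simpa [BAdj] using this
    let t' : G → G → Bool := fun x y => decide (BAdj (wordBall ev N) x y ∧ t x y)
    have htself : ∀ x, ¬t x x := fun x => by
      have := hc x x x (hrefl x) (hrefl x) (hrefl x)
      simp only [Xor] at this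
      tauto
    have hts : ∀ x y, t' x y = t' y x := by
      intro x y
      by_cases h : BAdj (wordBall ev N) x y
      · have := hc x y x h (hsymm _ _ h) (hrefl x)
        have h2 := htself x
        simp only [t', h, hsymm _ _ h, true_and, decide_eq_decide]
        rw [Xor] at this
        tauto
      · have h' : ¬BAdj (wordBall ev N) y x := fun h' => h (hsymm _ _ h')
        simp [t', h, h']
    have hc' : ∀ x y z, BAdj (wordBall ev N) x y → BAdj (wordBall ev N) y z →
        BAdj (wordBall ev N) x z → t' x z = (t' x y ^^ t' y z) := by
      intro x y z h1 h2 h3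
      have := hc x y z h1 h2 h3
      simp only [t', h1, h2, h3, true_and]
      rw [Xor] at this
      by_cases a1 : t x y <;> by_cases a2 : t y z <;> by_cases a3 : t x z <;> simp_all
    have key := lift_twistPerm ev hN t' hts hc'
    have hrel : ∀ r ∈ rels,
        FreeGroup.lift (fun i => twistPerm t' hts (ev (FreeGroup.of i))) r = 1 := by
      intro r hrr
      ext1 p
      have h1 : ev r = 1 := by
        rw [hev]
        simp [PresentedGroup.one_of_mem hrr]
      have := key r.toWord (hr r hrr) p.1 p.2
      rw [FreeGroup.mk_toWord, h1] at this
      rw [Equiv.Perm.one_apply]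
      refine this.trans ?_
      ext <;> simp [t', htself]
    let ψ := PresentedGroup.toGroup hrel
    have hψ : ∀ w, ψ (φ.symm (ev w)) =
        FreeGroup.lift (fun i => twistPerm t' hts (ev (FreeGroup.of i))) w := fun w => by
      have h1 : φ.symm (ev w) = PresentedGroup.mk rels w := by simp [hev]
      rw [h1]
      rfl
    have hfst : ∀ (w : FreeGroup (Fin n)) (p : G × Bool),
        (ψ (φ.symm (ev w)) p).1 = p.1 * (ev w)⁻¹ := by
      intro w
      induction w using FreeGroup.induction_on with
      | C1 => simp
      | of i => intro p; rw [hψ]; simp [twistPerm]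
      | inv_of i h => intro p; rw [hψ]; simp [twistPerm, Equiv.Perm.inv_def]
      | mul x y hx hy => intro p; simp only [map_mul, Equiv.Perm.mul_apply, hx, hy]; group
    refine ⟨fun x => (ψ (φ.symm x⁻¹) (1, false)).2 = true, fun x y hxy => ?_⟩
    obtain ⟨w, hw⟩ := hsurj x⁻¹
    obtain ⟨l, hl, hlb⟩ := mem_wordBall_inv hxy
    have hy : y⁻¹ = ev (FreeGroup.mk l) * x⁻¹ := by rw [hlb]; group
    have hx1 : ψ (φ.symm x⁻¹) (1, false) = (x, (ψ (φ.symm x⁻¹) (1, false)).2) := by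
      ext1
      · rw [← hw, hfst, hw]; simp
      · rfl
    have : (ψ (φ.symm y⁻¹) (1, false)).2 = ((ψ (φ.symm x⁻¹) (1, false)).2 ^^ t' x y) := by
      rw [hy, map_mul, map_mul, Equiv.Perm.mul_apply, hx1, hψ, key l hl]
      simp [hlb]
    beta_reduce
    rw [this]
    have hxy' : BAdj (wordBall ev N) x y := hxy
    simp only [t', hxy', true_and]
    cases h : (ψ (φ.symm x⁻¹) (1, false)).2 <;> simp

theorem exists_isCoclosed (h : FinitelyPresentedGroup G) : ∃ B : Set G, IsCoclosed B := by
  obtain ⟨n, rels, hf, ⟨φ⟩⟩ := h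
  obtain ⟨N, hN⟩ := (hf.image fun r => r.toWord.length).bddAbove
  exact ⟨_, isCoclosed_wordBall rels φ (N := N + 1) (by omega)
    fun r hr => (hN ⟨r, hr, rfl⟩).trans (by omega)⟩

end Presentation

/-! ### Finite generation of stabilizers -/

section Stabilizers

variable {G P : Type*} [Group G] [MulAction G P]

theorem fg_of_reflTransGen (r : P → P → Prop) (hsymm : ∀ p q, r p q → r q p)
    (hinv : ∀ (g : G) p q, r p q → r (g • p) (g • q)) (hfree : ∀ (g : G) (p : P), g • p = p → g = 1)
    (hlf : ∀ p, {q | r p q}.Finite) (p₀ : P)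
    (hcof : ∃ F : Set P, F.Finite ∧ ∀ q, Relation.ReflTransGen r p₀ q → ∃ g : G, g • q ∈ F)
    (K : Subgroup G) (hK : ∀ g, g ∈ K ↔ Relation.ReflTransGen r p₀ (g • p₀)) : K.FG := by
  classical
  have hsym : ∀ {p q}, Relation.ReflTransGen r p q → Relation.ReflTransGen r q p := by
    intro p q h
    induction h with
    | refl => exact .refl
    | tail _ h ih => exact .head (hsymm _ _ h) ih
  have hact : ∀ (g : G) {p q}, Relation.ReflTransGen r p q →
      Relation.ReflTransGen r (g • p) (g • q) := fun g p q h =>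
    h.lift (g • ·) fun _ _ h => hinv g _ _ h
  have hinj : ∀ (p : P), Function.Injective fun g : G => g • p := by
    intro p g h hgh
    have : h⁻¹ * g = 1 := hfree _ p (by simp only at hgh; rw [mul_smul, hgh, inv_smul_smul])
    rw [inv_mul_eq_one] at this
    exact this.symm
  obtain ⟨F, hF, hcov⟩ := hcof
  -- representatives, in the class of `p₀`, of the orbits meeting this class
  let rep : P → P := fun q => if h : ∃ g : G, Relation.ReflTransGen r p₀ (g • q) then
    h.choose • q else p₀
  have hrep : ∀ q, Relation.ReflTransGen r p₀ (rep q) := by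
    intro q
    simp only [rep]
    split_ifs with h
    · exact h.choose_spec
    · exact .refl
  let R : Set P := insert p₀ (rep '' F)
  have hRfin : R.Finite := (hF.image _).insert _
  have hR : ∀ q ∈ R, Relation.ReflTransGen r p₀ q := by
    rintro q (rfl | ⟨q', _, rfl⟩)
    exacts [.refl, hrep _]
  have hmemK : ∀ (k : G) (q : P), Relation.ReflTransGen r p₀ q →
      Relation.ReflTransGen r p₀ (k • q) → k ∈ K := fun k q h1 h2 =>
    (hK k).2 (h2.trans (hact k (hsym h1)))
  have hcovR : ∀ q, Relation.ReflTransGen r p₀ q → ∃ k ∈ K, ∃ s ∈ R, q = k • s := by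
    intro q hq
    obtain ⟨g, hg⟩ := hcov q hq
    have hex : ∃ g' : G, Relation.ReflTransGen r p₀ (g' • (g • q)) := ⟨g⁻¹, by simpa using hq⟩
    have hr : rep (g • q) = hex.choose • (g • q) := by simp only [rep]; rw [dif_pos hex]
    have hq' : q = (g⁻¹ * hex.choose⁻¹) • rep (g • q) := by rw [hr, mul_smul]; simp
    refine ⟨_, hmemK _ (rep (g • q)) (hrep _) ?_, rep (g • q), Or.inr ⟨_, hg, rfl⟩, hq'⟩
    rwa [← hq']
  let gen : Set G := {k | k ∈ K ∧ ∃ s ∈ R, ∃ s' ∈ R, r s (k • s') ∨ k • s' = s}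
  have hgen : gen.Finite := by
    have : (⋃ s ∈ R, ⋃ s' ∈ R, (fun g : G => g • s') ⁻¹' ({q | r s q} ∪ {s})).Finite := by
      refine hRfin.biUnion fun s _ => hRfin.biUnion fun s' _ => ?_
      exact ((hlf s).union (Set.finite_singleton s)).preimage (hinj s').injOn
    refine this.subset ?_
    rintro k ⟨_, s, hs, s', hs', h⟩
    simp only [Set.mem_iUnion]
    exact ⟨s, hs, s', hs', by simpa [or_comm] using h⟩
  have hle : Subgroup.closure gen ≤ K := (Subgroup.closure_le K).2 fun k hk => hk.1
  have hreach : ∀ q, Relation.ReflTransGen r p₀ q →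
      ∃ h ∈ Subgroup.closure gen, ∃ s ∈ R, q = h • s := by
    intro q hq
    induction hq with
    | refl => exact ⟨1, one_mem _, p₀, Or.inl rfl, by simp⟩
    | @tail q q' hq hqq' ih =>
      obtain ⟨h, hh, s, hs, rfl⟩ := ih
      obtain ⟨k, hk, s', hs', rfl⟩ := hcovR q' (hq.tail hqq')
      refine ⟨k, ?_, s', hs', rfl⟩
      have : h⁻¹ * k ∈ gen := by
        refine ⟨mul_mem (inv_mem (hle hh)) hk, s, hs, s', hs', Or.inl ?_⟩
        have := hinv h⁻¹ _ _ hqq'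
        rwa [inv_smul_smul, ← mul_smul] at this
      simpa using mul_mem hh (Subgroup.subset_closure this)
  refine (Subgroup.fg_iff K).2 ⟨gen, le_antisymm hle fun k hk => ?_, hgen⟩
  obtain ⟨h, hh, s, hs, hks⟩ := hreach _ ((hK k).1 hk)
  have : h⁻¹ * k ∈ gen :=
    ⟨mul_mem (inv_mem (hle hh)) hk, s, hs, p₀, Or.inl rfl,
      Or.inr (by rw [mul_smul, hks, inv_smul_smul])⟩
  simpa using mul_mem hh (Subgroup.subset_closure this)

end Stabilizers

/-! ### Classes of labelled edges of the complex -/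

section Classes

variable {G Λ : Type*} [Group G] {B : Set G} {R : Λ → G → G → Prop}

/-- The edge `p.2` of the complex defined by `B` carries the label `p.1`. -/
structure Valid (B : Set G) (R : Λ → G → G → Prop) (p : Λ × G × G) : Prop where
  adj : BAdj B p.2.1 p.2.2
  rel : R p.1 p.2.1 p.2.2

/-- Two edges spanning a simplex and carrying the same label. -/
structure Link (B : Set G) (R : Λ → G → G → Prop) (p q : Λ × G × G) : Prop where
  fst_eq : p.1 = q.1
  left : Valid B R p
  right : Valid B R q
  adj₁₁ : BAdj B p.2.1 q.2.1
  adj₁₂ : BAdj B p.2.1 q.2.2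
  adj₂₁ : BAdj B p.2.2 q.2.1
  adj₂₂ : BAdj B p.2.2 q.2.2

/-- The equivalence relation generated by `Link`. -/
def Conn (B : Set G) (R : Λ → G → G → Prop) : Λ × G × G → Λ × G × G → Prop :=
  Relation.ReflTransGen (Link B R)

theorem Link.symm (hB : IsCoclosed B) {p q : Λ × G × G} (h : Link B R p q) : Link B R q p :=
  ⟨h.fst_eq.symm, h.right, h.left, hB.symm h.adj₁₁, hB.symm h.adj₂₁, hB.symm h.adj₁₂,
    hB.symm h.adj₂₂⟩

theorem Link.conn {p q : Λ × G × G} (h : Link B R p q) : Conn B R p q := .single h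

theorem Conn.refl (p : Λ × G × G) : Conn B R p p := Relation.ReflTransGen.refl

theorem Conn.trans {p q r : Λ × G × G} (h : Conn B R p q) (h' : Conn B R q r) : Conn B R p r :=
  Relation.ReflTransGen.trans h h'

theorem Conn.symm (hB : IsCoclosed B) {p q : Λ × G × G} (h : Conn B R p q) : Conn B R q p := by
  induction h with
  | refl => exact .refl _
  | tail _ h ih => exact .trans (h.symm hB).conn ih

theorem Conn.fst_eq {p q : Λ × G × G} (h : Conn B R p q) : p.1 = q.1 := by
  induction h with
  | refl => rfl
  | tail _ h ih => exact ih.trans h.fst_eq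

theorem Conn.valid {p q : Λ × G × G} (h : Conn B R p q) (hp : Valid B R p) : Valid B R q := by
  induction h with
  | refl => exact hp
  | tail _ h ih => exact h.right

theorem Conn.map {Λ' : Type*} {R' : Λ' → G → G → Prop} (f : Λ → Λ')
    (hR : ∀ l x y, R l x y → R' (f l) x y) {p q : Λ × G × G} (h : Conn B R p q) :
    Conn B R' (f p.1, p.2) (f q.1, q.2) := by
  induction h with
  | refl => exact .refl _
  | tail _ h ih =>
    exact ih.trans (Link.conn ⟨congrArg f h.fst_eq, ⟨h.left.1, hR _ _ _ h.left.2⟩,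
      ⟨h.right.1, hR _ _ _ h.right.2⟩, h.adj₁₁, h.adj₁₂, h.adj₂₁, h.adj₂₂⟩)

theorem finite_valid_one (hB : IsCoclosed B) (hfin : ∀ b, {l | R l 1 b}.Finite) :
    {p : Λ × G × G | Valid B R p ∧ p.2.1 = 1}.Finite := by
  have : (⋃ b ∈ B, (fun l => (l, (1 : G), b)) '' {l | R l 1 b}).Finite :=
    hB.finite.biUnion fun b _ => (hfin b).image _
  refine this.subset ?_
  rintro ⟨l, x, y⟩ ⟨⟨h1, h2⟩, rfl : x = 1⟩
  simp only [Set.mem_iUnion]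
  exact ⟨y, by simpa [BAdj] using h1, l, h2, rfl⟩

variable [MulAction G Λ]

theorem Valid.smul (hR : ∀ (g : G) l x y, R l x y → R (g • l) (g * x) (g * y))
    (g : G) {p : Λ × G × G} (h : Valid B R p) : Valid B R (g • p) :=
  ⟨h.1.smul g, hR g _ _ _ h.2⟩

theorem Link.smul (hR : ∀ (g : G) l x y, R l x y → R (g • l) (g * x) (g * y))
    (g : G) {p q : Λ × G × G} (h : Link B R p q) : Link B R (g • p) (g • q) :=
  ⟨congrArg (g • ·) h.fst_eq, h.left.smul hR g, h.right.smul hR g, h.adj₁₁.smul g,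
    h.adj₁₂.smul g, h.adj₂₁.smul g, h.adj₂₂.smul g⟩

theorem Conn.smul (hR : ∀ (g : G) l x y, R l x y → R (g • l) (g * x) (g * y))
    (g : G) {p q : Λ × G × G} (h : Conn B R p q) : Conn B R (g • p) (g • q) := by
  induction h with
  | refl => exact .refl _
  | tail _ h ih => exact ih.trans (h.smul hR g).conn

theorem exists_smul_mem_valid_one (hR : ∀ (g : G) l x y, R l x y → R (g • l) (g * x) (g * y))
    {p : Λ × G × G} (hp : Valid B R p) :
    ∃ g : G, g • p ∈ {p : Λ × G × G | Valid B R p ∧ p.2.1 = 1} :=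
  ⟨p.2.1⁻¹, hp.smul hR _, inv_mul_cancel _⟩

theorem fg_of_conn (hB : IsCoclosed B) (hR : ∀ (g : G) l x y, R l x y → R (g • l) (g * x) (g * y))
    (hfin : ∀ b, {l | R l 1 b}.Finite) {p : Λ × G × G} (hp : Valid B R p)
    (K : Subgroup G) (hK : ∀ g, g ∈ K ↔ Conn B R p (g • p)) : K.FG := by
  refine fg_of_reflTransGen (Link B R) (fun _ _ h => h.symm hB) (fun g _ _ h => h.smul hR g)
    ?_ ?_ p ⟨_, finite_valid_one hB hfin, fun q hq => exists_smul_mem_valid_one hR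
      (Conn.valid hq hp)⟩ K hK
  · intro g p h
    have : g * p.2.1 = p.2.1 := congrArg (fun p => p.2.1) h
    simpa using this
  · intro p
    refine (((Set.finite_singleton p.1).prod ((hB.finite.image (p.2.1 * ·)).prod
      (hB.finite.image (p.2.2 * ·))))).subset fun q hq => ?_
    exact ⟨hq.fst_eq.symm, ⟨_, hq.adj₁₁, by simp⟩, ⟨_, hq.adj₂₂, by simp⟩⟩

end Classes

/-! ### Actions on trees -/

namespace GTree

open TreeSep

variable {G : Type u} [Group G]

instance (T : GTree G) : MulAction G T.V where
  smul := T.act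
  one_smul := T.act_one
  mul_smul := T.act_mul

theorem isTree (T : GTree G) : T.graph.IsTree := ⟨T.connected, T.acyclic⟩

/-- The graph automorphism given by an element of `G`. -/
def smulHom (T : GTree G) (g : G) : T.graph →g T.graph where
  toFun w := g • w
  map_rel' h := T.act_adj g _ _ h

theorem adj_smul (T : GTree G) (g : G) {a b : T.V} (h : T.graph.Adj a b) :
    T.graph.Adj (g • a) (g • b) := T.act_adj g _ _ h

end GTree

namespace TreeSep

variable {V : Type*} {Γ : SimpleGraph V}

theorem sep_iff_forall_mem_edges (hΓ : Γ.IsTree) {a b x y : V} :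
    Sep Γ a b x y ↔ ∀ p : Γ.Walk x y, s(a, b) ∈ p.edges :=
  ⟨fun h => h.mem_edges, fun h => by
    obtain ⟨p, -, -, hp⟩ := exists_walk_sep hΓ x y
    exact hp a b (h p)⟩

theorem sep_trans_iff {a b x y z : V} :
    Sep Γ a b x z ↔ Xor (Sep Γ a b x y) (Sep Γ a b y z) := by
  simp only [Sep, Xor]
  tauto

theorem OnSeg.smul {G : Type u} [Group G] {T : GTree G} {v x y : T.V} (g : G)
    (h : OnSeg T.graph v x y) : OnSeg T.graph (g • v) (g • x) (g • y) := by
  intro p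
  have := h ((p.map (T.smulHom g⁻¹)).copy
    (show T.smulHom g⁻¹ (g • x) = x from inv_smul_smul g x)
    (show T.smulHom g⁻¹ (g • y) = y from inv_smul_smul g y))
  simp only [SimpleGraph.Walk.support_copy, SimpleGraph.Walk.support_map, List.mem_map] at this
  obtain ⟨w, hw, hwv⟩ := this
  have : w = g • v := by rw [← hwv]; exact (smul_inv_smul g w).symm
  rwa [← this]

theorem Sep.smul {G : Type u} [Group G] {T : GTree G} {a b x y : T.V} (g : G)
    (h : Sep T.graph a b x y) : Sep T.graph (g • a) (g • b) (g • x) (g • y) := by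
  rw [sep_iff_forall_mem_edges T.isTree] at h ⊢
  intro p
  have := h ((p.map (T.smulHom g⁻¹)).copy
    (show T.smulHom g⁻¹ (g • x) = x from inv_smul_smul g x)
    (show T.smulHom g⁻¹ (g • y) = y from inv_smul_smul g y))
  simp only [SimpleGraph.Walk.edges_copy, SimpleGraph.Walk.edges_map, List.mem_map] at this
  obtain ⟨w, hw, hwv⟩ := this
  have : w = s(g • a, g • b) := by
    have := congrArg (Sym2.map fun w => g • w) hwv
    rw [Sym2.map_map] at this
    have hid : ((fun w : T.V => g • w) ∘ (T.smulHom g⁻¹)) = id := by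
      ext w
      exact smul_inv_smul g w
    rw [hid, Sym2.map_id] at this
    simpa using this
  rwa [← this]

end TreeSep

namespace GTree

open TreeSep

variable {G : Type u} [Group G]

/-! ### The resolution of an action on a tree -/

/-- The vertex `v` lies on the segment associated with an edge of the complex. -/
def VRel (T : GTree G) (o v : T.V) (x y : G) : Prop := OnSeg T.graph v (x • o) (y • o)

/-- The edge `e` lies on the segment associated with an edge of the complex. -/
def ERel (T : GTree G) (o : T.V) (e : T.V × T.V) (x y : G) : Prop :=
  T.graph.Adj e.1 e.2 ∧ Sep T.graph e.1 e.2 (x • o) (y • o)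

variable {T : GTree G} {o : T.V} {B : Set G}

theorem VRel.smul (g : G) (v : T.V) (x y : G) (h : VRel T o v x y) :
    VRel T o (g • v) (g * x) (g * y) := by
  rw [VRel, mul_smul, mul_smul]
  exact OnSeg.smul g h

theorem ERel.smul (g : G) (e : T.V × T.V) (x y : G) (h : ERel T o e x y) :
    ERel T o (g • e) (g * x) (g * y) := by
  rw [ERel, mul_smul, mul_smul]
  exact ⟨T.adj_smul g h.1, h.2.smul g⟩

theorem finite_vRel (b : G) : {v | VRel T o v 1 b}.Finite := finite_onSeg T.connected _ _

theorem finite_eRel (b : G) : {e | ERel T o e 1 b}.Finite :=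
  (finite_sep T.connected _ _).subset fun _ h => h.2

theorem ERel.vRel_fst (e : T.V × T.V) (x y : G) (h : ERel T o e x y) : VRel T o e.1 x y :=
  h.2.onSeg_left

theorem ERel.vRel_snd (e : T.V × T.V) (x y : G) (h : ERel T o e x y) : VRel T o e.2 x y :=
  h.2.onSeg_right

theorem ERel.swap {a b : T.V} {x y : G} (h : ERel T o (a, b) x y) : ERel T o (b, a) x y :=
  ⟨h.1.symm, (sep_comm T.isTree h.1 _ _).1 h.2⟩

/-- The characteristic function of the track containing a given labelled edge is a cocycle. -/
theorem conn_cocycle (hB : IsCoclosed B) {p : (T.V × T.V) × G × G} (hp : Valid B (ERel T o) p)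
    {x y z : G} (hxy : BAdj B x y) (hyz : BAdj B y z) (hxz : BAdj B x z) :
    Conn B (ERel T o) p (p.1, x, z) ↔
      Xor (Conn B (ERel T o) p (p.1, x, y)) (Conn B (ERel T o) p (p.1, y, z)) := by
  have hadj := hp.2.1
  have hs : Sep T.graph p.1.1 p.1.2 (x • o) (z • o) ↔ _ := sep_trans_iff (y := y • o)
  have hv : ∀ {x y}, Conn B (ERel T o) p (p.1, x, y) →
      Sep T.graph p.1.1 p.1.2 (x • o) (y • o) := fun h => (h.valid hp).2.2
  have hl : ∀ {x y x' y'}, Conn B (ERel T o) p (p.1, x, y) →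
      Sep T.graph p.1.1 p.1.2 (x' • o) (y' • o) → BAdj B x y → BAdj B x' y' → BAdj B x x' →
      BAdj B x y' → BAdj B y x' → BAdj B y y' → Conn B (ERel T o) p (p.1, x', y') :=
    fun h hs h1 h2 h3 h4 h5 h6 => h.trans
      (Link.conn ⟨rfl, ⟨h1, hadj, hv h⟩, ⟨h2, hadj, hs⟩, h3, h4, h5, h6⟩)
  have hyx := hB.symm hxy
  have hzy := hB.symm hyz
  have hzx := hB.symm hxz
  have e1 : Conn B (ERel T o) p (p.1, x, z) → Sep T.graph p.1.1 p.1.2 (x • o) (y • o) →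
    Conn B (ERel T o) p (p.1, x, y) := fun h h' => hl h h' hxz hxy (hB.refl _) hxy hzx hzy
  have e2 : Conn B (ERel T o) p (p.1, x, z) → Sep T.graph p.1.1 p.1.2 (y • o) (z • o) →
    Conn B (ERel T o) p (p.1, y, z) := fun h h' => hl h h' hxz hyz hxy hxz hzy (hB.refl _)
  have e3 : Conn B (ERel T o) p (p.1, x, y) → Sep T.graph p.1.1 p.1.2 (x • o) (z • o) →
    Conn B (ERel T o) p (p.1, x, z) := fun h h' => hl h h' hxy hxz (hB.refl _) hxz hyx hyz
  have e4 : Conn B (ERel T o) p (p.1, x, y) → Sep T.graph p.1.1 p.1.2 (y • o) (z • o) →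
    Conn B (ERel T o) p (p.1, y, z) := fun h h' => hl h h' hxy hyz hxy hxz (hB.refl _) hyz
  have e5 : Conn B (ERel T o) p (p.1, y, z) → Sep T.graph p.1.1 p.1.2 (x • o) (y • o) →
    Conn B (ERel T o) p (p.1, x, y) := fun h h' => hl h h' hyz hxy hyx (hB.refl _) hzx hzy
  have e6 : Conn B (ERel T o) p (p.1, y, z) → Sep T.graph p.1.1 p.1.2 (x • o) (z • o) →
    Conn B (ERel T o) p (p.1, x, z) := fun h h' => hl h h' hyz hxz hyx hyz hzx (hB.refl _)
  have v1 := hv (x := x) (y := y)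
  have v2 := hv (x := y) (y := z)
  have v3 := hv (x := x) (y := z)
  simp only [Xor] at hs ⊢
  by_cases s1 : Sep T.graph p.1.1 p.1.2 (x • o) (y • o) <;>
    by_cases s2 : Sep T.graph p.1.1 p.1.2 (y • o) (z • o) <;> simp_all <;> tauto

theorem exists_conn_primitive (hB : IsCoclosed B) {p : (T.V × T.V) × G × G}
    (hp : Valid B (ERel T o) p) : ∃ A : G → Prop, ∀ x y, BAdj B x y →
      (Conn B (ERel T o) p (p.1, x, y) ↔ Xor (A x) (A y)) :=
  hB.exists_primitive (fun x y => Conn B (ERel T o) p (p.1, x, y))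
    fun _ _ _ h1 h2 h3 => conn_cocycle hB hp h1 h2 h3

end GTree

namespace GTree

open TreeSep

variable {G : Type u} [Group G] {T : GTree G} {o : T.V} {B : Set G}

/-- The equivalence relation defining the vertices of the resolution. -/
def resSetoid (T : GTree G) (o : T.V) (hB : IsCoclosed B) :
    Setoid {p : T.V × G × G // Valid B (VRel T o) p} where
  r p q := Conn B (VRel T o) p q
  iseqv := ⟨fun _ => .refl _, fun h => h.symm hB, fun h₁ h₂ => h₁.trans h₂⟩

/-- The vertices of the resolution. -/
def ResV (T : GTree G) (o : T.V) (hB : IsCoclosed B) : Type u := Quotient (resSetoid T o hB)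

/-- The vertex of the resolution defined by a labelled edge. -/
def resMk (T : GTree G) (o : T.V) (hB : IsCoclosed B) (p : T.V × G × G)
    (hp : Valid B (VRel T o) p) : ResV T o hB :=
  Quotient.mk (resSetoid T o hB) ⟨p, hp⟩

variable {hB : IsCoclosed B}

theorem resMk_eq_iff {p q : T.V × G × G} (hp : Valid B (VRel T o) p) (hq : Valid B (VRel T o) q) :
    resMk T o hB p hp = resMk T o hB q hq ↔ Conn B (VRel T o) p q :=
  Quotient.eq (r := resSetoid T o hB)

theorem exists_resMk (P : ResV T o hB) : ∃ p, ∃ hp, P = resMk T o hB p hp := by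
  induction P using Quotient.inductionOn with
  | h p => exact ⟨p.1, p.2, rfl⟩

/-- The natural map from the resolution to the tree. -/
def resProj (P : ResV T o hB) : T.V := Quotient.lift (s := resSetoid T o hB) (fun p => p.1.1)
  (fun _ _ h => h.fst_eq) P

@[simp]
theorem resProj_resMk (p : T.V × G × G) (hp : Valid B (VRel T o) p) :
    resProj (resMk T o hB p hp) = p.1 := rfl

instance : MulAction G (ResV T o hB) where
  smul g P := Quotient.map (sa := resSetoid T o hB) (sb := resSetoid T o hB)
    (fun p => ⟨g • p.1, p.2.smul VRel.smul g⟩) (fun _ _ h => h.smul VRel.smul g) P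
  one_smul P := by
    induction P using Quotient.inductionOn with
    | h p => exact Quotient.sound (s := resSetoid T o hB) (by
        show Conn B _ ((1 : G) • p.1) p.1
        rw [one_smul]
        exact .refl _)
  mul_smul g h P := by
    induction P using Quotient.inductionOn with
    | h p => exact Quotient.sound (s := resSetoid T o hB) (by
        show Conn B _ ((g * h) • p.1) (g • h • p.1)
        rw [mul_smul]
        exact .refl _)

theorem smul_resMk (g : G) (p : T.V × G × G) (hp : Valid B (VRel T o) p) :
    g • resMk T o hB p hp = resMk T o hB (g • p) (hp.smul VRel.smul g) := rfl

theorem resProj_smul (g : G) (P : ResV T o hB) : resProj (g • P) = g • resProj P := by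
  obtain ⟨p, hp, rfl⟩ := exists_resMk P
  rfl

theorem _root_.Valid.fst {p : (T.V × T.V) × G × G} (h : Valid B (ERel T o) p) :
    Valid B (VRel T o) (p.1.1, p.2) := ⟨h.adj, h.rel.vRel_fst⟩

theorem _root_.Valid.snd {p : (T.V × T.V) × G × G} (h : Valid B (ERel T o) p) :
    Valid B (VRel T o) (p.1.2, p.2) := ⟨h.adj, h.rel.vRel_snd⟩

/-- The pair of vertices of the resolution defined by a labelled edge. -/
structure IsResEdge (P Q : ResV T o hB) (p : (T.V × T.V) × G × G) : Prop where
  valid : Valid B (ERel T o) p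
  left : P = resMk T o hB (p.1.1, p.2) valid.fst
  right : Q = resMk T o hB (p.1.2, p.2) valid.snd

theorem IsResEdge.swap {P Q : ResV T o hB} {p : (T.V × T.V) × G × G} (h : IsResEdge P Q p) :
    IsResEdge Q P (p.1.swap, p.2) :=
  ⟨⟨h.valid.adj, h.valid.rel.swap⟩, h.right, h.left⟩

theorem IsResEdge.smul {P Q : ResV T o hB} {p : (T.V × T.V) × G × G} (h : IsResEdge P Q p)
    (g : G) : IsResEdge (g • P) (g • Q) (g • p) :=
  ⟨h.valid.smul ERel.smul g, congrArg (g • ·) h.left, congrArg (g • ·) h.right⟩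

theorem IsResEdge.proj_left {P Q : ResV T o hB} {p : (T.V × T.V) × G × G} (h : IsResEdge P Q p) :
    resProj P = p.1.1 := by rw [h.left, resProj_resMk]

theorem IsResEdge.proj_right {P Q : ResV T o hB} {p : (T.V × T.V) × G × G}
    (h : IsResEdge P Q p) : resProj Q = p.1.2 := by rw [h.right, resProj_resMk]

theorem IsResEdge.adj_proj {P Q : ResV T o hB} {p : (T.V × T.V) × G × G} (h : IsResEdge P Q p) :
    T.graph.Adj (resProj P) (resProj Q) := by
  rw [h.proj_left, h.proj_right]
  exact h.valid.rel.1

theorem IsResEdge.of_conn {P Q : ResV T o hB} {p q : (T.V × T.V) × G × G} (h : IsResEdge P Q p)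
    (hpq : Conn B (ERel T o) p q) : IsResEdge P Q q := by
  refine ⟨hpq.valid h.valid, ?_, ?_⟩
  · refine h.left.trans ((resMk_eq_iff _ _).2 ?_)
    exact hpq.map Prod.fst ERel.vRel_fst
  · refine h.right.trans ((resMk_eq_iff _ _).2 ?_)
    exact hpq.map Prod.snd ERel.vRel_snd

theorem IsResEdge.eq_and_eq {P Q P' Q' : ResV T o hB} {p : (T.V × T.V) × G × G}
    (h : IsResEdge P Q p) (h' : IsResEdge P' Q' p) : P = P' ∧ Q = Q' :=
  ⟨h.left.trans h'.left.symm, h.right.trans h'.right.symm⟩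

/-- The resolution of the action of `G` on `T`. -/
def resGraph (T : GTree G) (o : T.V) (hB : IsCoclosed B) : SimpleGraph (ResV T o hB) where
  Adj P Q := ∃ p, IsResEdge P Q p
  symm := ⟨fun _ _ ⟨_, h⟩ => ⟨_, h.swap⟩⟩
  loopless := ⟨fun _ ⟨_, h⟩ => h.adj_proj.ne rfl⟩

theorem valid_base (o : T.V) (hB : IsCoclosed B) (x : G) :
    Valid B (VRel T o) (x • o, x, x) := ⟨hB.refl x, onSeg_left _ _⟩

/-- The vertex of the resolution defined by a vertex of the complex. -/
def resBase (T : GTree G) (o : T.V) (hB : IsCoclosed B) (x : G) : ResV T o hB :=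
  resMk T o hB (x • o, x, x) (valid_base o hB x)

theorem smul_resBase (g x : G) : g • resBase T o hB x = resBase T o hB (g * x) := by
  rw [resBase, smul_resMk, resBase, resMk_eq_iff]
  have : (g * x) • o = g • x • o := mul_smul _ _ _
  rw [this]
  exact .refl _

theorem resProj_resBase (x : G) : resProj (resBase T o hB x) = x • o := rfl

theorem resBase_eq_left {x y : G} (h : BAdj B x y) : resBase T o hB x =
    resMk T o hB (x • o, x, y) ⟨h, onSeg_left _ _⟩ := by
  rw [resBase, resMk_eq_iff]
  exact Link.conn ⟨rfl, valid_base o hB x, ⟨h, onSeg_left _ _⟩, hB.refl x, h, hB.refl x, h⟩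

theorem resBase_eq_right {x y : G} (h : BAdj B x y) : resBase T o hB y =
    resMk T o hB (y • o, x, y) ⟨h, onSeg_right _ _⟩ := by
  rw [resBase, resMk_eq_iff]
  exact Link.conn ⟨rfl, valid_base o hB y, ⟨h, onSeg_right _ _⟩, hB.symm h, hB.refl y, hB.symm h,
    hB.refl y⟩

theorem reachable_of_walk {x y : G} (h : BAdj B x y) {u w : T.V} (p : T.graph.Walk u w)
    (hp : ∀ a b, s(a, b) ∈ p.edges → Sep T.graph a b (x • o) (y • o))
    (hu : VRel T o u x y) (hw : VRel T o w x y) :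
    (resGraph T o hB).Reachable (resMk T o hB (u, x, y) ⟨h, hu⟩)
      (resMk T o hB (w, x, y) ⟨h, hw⟩) := by
  induction p with
  | nil => exact .refl _
  | @cons u v w huv p ih =>
    have hs := hp u v (by simp)
    have hadj : (resGraph T o hB).Adj (resMk T o hB (u, x, y) ⟨h, hu⟩)
        (resMk T o hB (v, x, y) ⟨h, hs.onSeg_right⟩) :=
      ⟨((u, v), x, y), ⟨h, huv, hs⟩, rfl, rfl⟩
    exact hadj.reachable.trans (ih (fun a b hab => hp a b (by simp [hab])) hs.onSeg_right hw)

theorem reachable_resBase_resMk {x y : G} (h : BAdj B x y) {w : T.V} (hw : VRel T o w x y) :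
    (resGraph T o hB).Reachable (resBase T o hB x) (resMk T o hB (w, x, y) ⟨h, hw⟩) := by
  rw [resBase_eq_left h]
  obtain ⟨p, -, -, hp⟩ := exists_walk_sep T.isTree (x • o) w
  exact reachable_of_walk h p
    (fun a b hab => hw.sep T.isTree (p.adj_of_mem_edges hab) (hp a b hab))
    (onSeg_left _ _) hw

theorem resGraph_connected : (resGraph T o hB).Connected := by
  refine (SimpleGraph.connected_iff_exists_forall_reachable _).2 ⟨resBase T o hB 1, fun P => ?_⟩
  have hbase : ∀ x, (resGraph T o hB).Reachable (resBase T o hB 1) (resBase T o hB x) := by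
    intro x
    induction x using hB.induction 1 with
    | hx => exact .refl _
    | h y z hyz ih =>
      rw [resBase_eq_right hyz]
      exact ih.trans (reachable_resBase_resMk hyz (onSeg_right _ _))
  obtain ⟨⟨w, x, y⟩, ⟨h, hw⟩, rfl⟩ := exists_resMk P
  exact (hbase x).trans (reachable_resBase_resMk h hw)

/-- A track cuts the resolution into two sides. -/
theorem exists_side (hB : IsCoclosed B) {p : (T.V × T.V) × G × G} (hp : Valid B (ERel T o) p)
    {A : G → Prop}
    (hA : ∀ x y, BAdj B x y → (Conn B (ERel T o) p (p.1, x, y) ↔ Xor (A x) (A y))) :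
    ∃ σ : ResV T o hB → Prop, (∀ x, σ (resBase T o hB x) ↔ A x) ∧
      ∀ P Q q, IsResEdge P Q q → (¬(σ P ↔ σ Q) ↔
        Conn B (ERel T o) p (p.1, q.2) ∧ s(q.1.1, q.1.2) = s(p.1.1, p.1.2)) := by
  have hadj := hp.2.1
  have hl : ∀ {x y x' y'}, Conn B (ERel T o) p (p.1, x, y) →
      Sep T.graph p.1.1 p.1.2 (x' • o) (y' • o) → BAdj B x y → BAdj B x' y' → BAdj B x x' →
      BAdj B x y' → BAdj B y x' → BAdj B y y' → Conn B (ERel T o) p (p.1, x', y') :=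
    fun h hs h1 h2 h3 h4 h5 h6 => h.trans
      (Link.conn ⟨rfl, ⟨h1, hadj, (h.valid hp).2.2⟩, ⟨h2, hadj, hs⟩, h3, h4, h5, h6⟩)
  let f : T.V × G × G → Prop := fun q => Xor (A q.2.1)
    (Conn B (ERel T o) p (p.1, q.2) ∧ Sep T.graph p.1.1 p.1.2 (q.2.1 • o) q.1)
  have hf : ∀ q q', Link B (VRel T o) q q' → (f q ↔ f q') := by
    rintro ⟨v, x, y⟩ ⟨v', x', y'⟩ ⟨rfl : v = v', ⟨hxy : BAdj B x y, hv⟩,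
      ⟨hxy' : BAdj B x' y', hv'⟩, h11 : BAdj B x x', h12 : BAdj B x y', h21 : BAdj B y x',
      h22 : BAdj B y y'⟩
    have hxx := hA x x' h11
    have hs : Sep T.graph p.1.1 p.1.2 (x • o) (x' • o) ↔ _ := sep_trans_iff (y := v)
    have hs1 : Sep T.graph p.1.1 p.1.2 (x • o) v → Sep T.graph p.1.1 p.1.2 (x • o) (y • o) :=
      hv.sep T.isTree hadj
    have hs2 : Sep T.graph p.1.1 p.1.2 (x' • o) v → Sep T.graph p.1.1 p.1.2 (x' • o) (y' • o) :=
      hv'.sep T.isTree hadj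
    have hs3 : Sep T.graph p.1.1 p.1.2 v (x' • o) ↔ Sep T.graph p.1.1 p.1.2 (x' • o) v :=
      ⟨Sep.symm, Sep.symm⟩
    have k1 : Conn B (ERel T o) p (p.1, x, x') → Sep T.graph p.1.1 p.1.2 (x • o) (x' • o) :=
      fun h => (h.valid hp).2.2
    have c1 : Conn B (ERel T o) p (p.1, x, x') → Sep T.graph p.1.1 p.1.2 (x • o) (y • o) →
      Conn B (ERel T o) p (p.1, x, y) := fun h h' =>
      hl h h' h11 hxy (hB.refl x) hxy (hB.symm h11) (hB.symm h21)
    have c2 : Conn B (ERel T o) p (p.1, x, y) → Sep T.graph p.1.1 p.1.2 (x • o) (x' • o) →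
      Conn B (ERel T o) p (p.1, x, x') := fun h h' =>
      hl h h' hxy h11 (hB.refl x) h11 (hB.symm hxy) h21
    have c3 : Conn B (ERel T o) p (p.1, x, x') → Sep T.graph p.1.1 p.1.2 (x' • o) (y' • o) →
      Conn B (ERel T o) p (p.1, x', y') := fun h h' =>
      hl h h' h11 hxy' h11 h12 (hB.refl x') hxy'
    have c4 : Conn B (ERel T o) p (p.1, x', y') → Sep T.graph p.1.1 p.1.2 (x • o) (x' • o) →
      Conn B (ERel T o) p (p.1, x, x') := fun h h' =>
      hl h h' hxy' h11 (hB.symm h11) (hB.refl x') (hB.symm h12) (hB.symm hxy')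
    have c5 : Conn B (ERel T o) p (p.1, x, y) → Sep T.graph p.1.1 p.1.2 (x' • o) (y' • o) →
      Conn B (ERel T o) p (p.1, x', y') := fun h h' =>
      hl h h' hxy hxy' h11 h12 h21 h22
    have c6 : Conn B (ERel T o) p (p.1, x', y') → Sep T.graph p.1.1 p.1.2 (x • o) (y • o) →
      Conn B (ERel T o) p (p.1, x, y) := fun h h' =>
      hl h h' hxy' hxy (hB.symm h11) (hB.symm h21) (hB.symm h12) (hB.symm h22)
    simp only [Xor, f] at hs hxx ⊢
    clear hl hA
    generalize Conn B (ERel T o) p (p.1, x, y) = t₁ at *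
    generalize Conn B (ERel T o) p (p.1, x', y') = t₂ at *
    generalize Conn B (ERel T o) p (p.1, x, x') = t₃ at *
    generalize Sep T.graph p.1.1 p.1.2 (x • o) v = s₁ at *
    generalize Sep T.graph p.1.1 p.1.2 (x' • o) v = s₂ at *
    generalize Sep T.graph p.1.1 p.1.2 (x • o) (y • o) = s₃ at *
    generalize Sep T.graph p.1.1 p.1.2 (x' • o) (y' • o) = s₄ at *
    generalize Sep T.graph p.1.1 p.1.2 (x • o) (x' • o) = s₅ at *
    generalize Sep T.graph p.1.1 p.1.2 v (x' • o) = s₆ at *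
    generalize A x = a at *
    generalize A x' = a' at *
    clear * - hxx hs hs1 hs2 hs3 k1 c1 c2 c3 c4 c5 c6
    grind
  have hf' : ∀ q q', Conn B (VRel T o) q q' → (f q ↔ f q') := by
    intro q q' h
    induction h with
    | refl => rfl
    | tail _ h ih => exact ih.trans (hf _ _ h)
  refine ⟨Quotient.lift (s := resSetoid T o hB) (fun q => f q.1)
    (fun q q' h => propext (hf' _ _ h)), fun x => ?_, fun P Q q h => ?_⟩
  · show f (x • o, x, x) ↔ A x
    have := not_sep_self (Γ := T.graph) p.1.1 p.1.2 (x • o)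
    simp [f, this, Xor]
  · obtain ⟨hv, rfl, rfl⟩ := h
    show ¬(f (q.1.1, q.2) ↔ f (q.1.2, q.2)) ↔ _
    have h1 := sep_iff_of_adj T.acyclic hadj hv.rel.1
    have h2 : Sep T.graph p.1.1 p.1.2 (q.2.1 • o) q.1.2 ↔ _ := sep_trans_iff (y := q.1.1)
    rw [← h1]
    simp only [f, Xor] at h2 ⊢
    tauto

theorem exists_side' (hB : IsCoclosed B) {p : (T.V × T.V) × G × G}
    (hp : Valid B (ERel T o) p) :
    ∃ σ : ResV T o hB → Prop,
      ∀ P Q q, IsResEdge P Q q → (¬(σ P ↔ σ Q) ↔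
        Conn B (ERel T o) p (p.1, q.2) ∧ s(q.1.1, q.1.2) = s(p.1.1, p.1.2)) := by
  obtain ⟨A, hA⟩ := exists_conn_primitive hB hp
  obtain ⟨σ, -, hσ⟩ := exists_side hB hp hA
  exact ⟨σ, hσ⟩

theorem resGraph_isAcyclic : (resGraph T o hB).IsAcyclic := by
  rw [SimpleGraph.isAcyclic_iff_forall_adj_isBridge]
  rintro P Q ⟨p, h⟩
  rw [SimpleGraph.isBridge_iff_forall_walk_mem_edges]
  obtain ⟨σ, hσ⟩ := exists_side' hB h.valid
  intro W
  obtain ⟨U, U', ⟨q, hq⟩, hm, hne⟩ := exists_step σ W ((hσ P Q p h).2 ⟨.refl _, rfl⟩)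
  obtain ⟨h1, h2⟩ := (hσ _ _ _ hq).1 hne
  have h3 := h.of_conn h1
  rcases Sym2.eq_iff.1 h2 with ⟨h4, h5⟩ | ⟨h4, h5⟩
  · have : q = (p.1, q.2) := Prod.ext (Prod.ext h4 h5) rfl
    rw [← this] at h3
    obtain ⟨rfl, rfl⟩ := h3.eq_and_eq hq
    exact hm
  · have : (q.1.swap, q.2) = (p.1, q.2) := Prod.ext (Prod.ext h5 h4) rfl
    rw [← this] at h3
    obtain ⟨rfl, rfl⟩ := h3.eq_and_eq hq.swap
    rwa [Sym2.eq_swap]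

theorem IsResEdge.conn {P Q : ResV T o hB} {p q : (T.V × T.V) × G × G} (h : IsResEdge P Q p)
    (h' : IsResEdge P Q q) : Conn B (ERel T o) p q := by
  obtain ⟨σ, hσ⟩ := exists_side' hB h.valid
  have := ((hσ P Q q h').1 ((hσ P Q p h).2 ⟨.refl _, rfl⟩)).1
  have hpq : (p.1, q.2) = q := Prod.ext (Prod.ext
    (h.proj_left.symm.trans h'.proj_left) (h.proj_right.symm.trans h'.proj_right)) rfl
  rwa [hpq] at this

theorem resGraph_isTree : (resGraph T o hB).IsTree := ⟨resGraph_connected, resGraph_isAcyclic⟩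

theorem resGraph_adj_smul (g : G) (P Q : ResV T o hB) (h : (resGraph T o hB).Adj P Q) :
    (resGraph T o hB).Adj (g • P) (g • Q) := by
  obtain ⟨p, h⟩ := h
  exact ⟨_, h.smul g⟩

theorem resGraph_adj_proj (P Q : ResV T o hB) (h : (resGraph T o hB).Adj P Q) :
    T.graph.Adj (resProj P) (resProj Q) := h.elim fun _ h => h.adj_proj

theorem resGraph_noInversion (g : G) (P Q : ResV T o hB) (h : (resGraph T o hB).Adj P Q) :
    ¬(g • P = Q ∧ g • Q = P) := by
  rintro ⟨h1, h2⟩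
  refine T.noInversion g _ _ (resGraph_adj_proj P Q h) ⟨?_, ?_⟩
  · show g • resProj P = resProj Q
    rw [← resProj_smul, h1]
  · show g • resProj Q = resProj P
    rw [← resProj_smul, h2]

theorem resV_stabilizer_fg (P : ResV T o hB) : (MulAction.stabilizer G P).FG := by
  obtain ⟨p, hp, rfl⟩ := exists_resMk P
  refine fg_of_conn hB VRel.smul finite_vRel hp _ fun g => ?_
  rw [MulAction.mem_stabilizer_iff, smul_resMk, resMk_eq_iff]
  exact ⟨fun h => h.symm hB, fun h => h.symm hB⟩

theorem resV_edge_stabilizer_fg (P Q : ResV T o hB) (h : (resGraph T o hB).Adj P Q) :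
    (MulAction.stabilizer G P ⊓ MulAction.stabilizer G Q).FG := by
  obtain ⟨p, h⟩ := h
  refine fg_of_conn hB ERel.smul finite_eRel h.valid _ fun g => ?_
  rw [Subgroup.mem_inf, MulAction.mem_stabilizer_iff, MulAction.mem_stabilizer_iff]
  constructor
  · rintro ⟨h1, h2⟩
    have := h.smul g
    rw [h1, h2] at this
    exact h.conn this
  · intro hc
    exact (h.smul g).eq_and_eq (h.of_conn hc)

theorem exists_finite_resV (T : GTree G) (o : T.V) (hB : IsCoclosed B) :
    ∃ F : Set (ResV T o hB), F.Finite ∧ ∀ P, ∃ g : G, g • P ∈ F := by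
  refine ⟨{P | ∃ p, ∃ hp : Valid B (VRel T o) p, p.2.1 = 1 ∧ P = resMk T o hB p hp}, ?_,
    fun P => ?_⟩
  · have hfin := finite_valid_one (R := VRel T o) hB finite_vRel
    refine (hfin.dependent_image fun p hp => resMk T o hB p hp.1).subset ?_
    rintro P ⟨p, hp, h1, rfl⟩
    exact ⟨p, ⟨hp, h1⟩, rfl⟩
  · obtain ⟨p, hp, rfl⟩ := exists_resMk P
    obtain ⟨g, hg, hg'⟩ := exists_smul_mem_valid_one (VRel.smul (T := T) (o := o)) hp
    exact ⟨g, g • p, hg, hg', rfl⟩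

end GTree

namespace GTree

variable {G : Type u} [Group G]

/-- A cocompact action without inversions on a tree has a minimal invariant subtree. -/
theorem exists_minimal_subtree {V : Type u} [MulAction G V] {Γ : SimpleGraph V} (hΓ : Γ.IsTree)
    (hadj : ∀ (g : G) a b, Γ.Adj a b → Γ.Adj (g • a) (g • b))
    (hinv : ∀ (g : G) a b, Γ.Adj a b → ¬(g • a = b ∧ g • b = a))
    {F : Set V} (hF : F.Finite) (hcov : ∀ v, ∃ g : G, g • v ∈ F) :
    ∃ (S : GTree G) (ι : S.V → V), (∀ (g : G) w, ι (g • w) = g • ι w) ∧ Function.Injective ι ∧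
      ∀ a b, S.graph.Adj a b → Γ.Adj (ι a) (ι b) := by
  let good : Set (Set V) :=
    {S | S.Nonempty ∧ (∀ (g : G), ∀ w ∈ S, g • w ∈ S) ∧ (Γ.induce S).Connected}
  have huniv : Set.univ ∈ good := by
    obtain ⟨v⟩ := hΓ.1.nonempty
    exact ⟨⟨v, trivial⟩, fun _ _ _ => trivial,
      (SimpleGraph.induceUnivIso Γ).connected_iff.2 hΓ.1⟩
  obtain ⟨S, ⟨hne, hS, hconn⟩, hmin⟩ :=
    WellFounded.has_min (measure fun S : Set V => (F ∩ S).ncard).wf good ⟨_, huniv⟩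
  have hmin' : ∀ S' ∈ good, S' ⊆ S → S' = S := by
    intro S' hS' hsub
    refine hsub.antisymm fun v hv => ?_
    have h1 : F ∩ S' = F ∩ S := Set.eq_of_subset_of_ncard_le
      (Set.inter_subset_inter_right F hsub) (not_lt.1 (hmin S' hS')) (hF.inter_of_left S)
    obtain ⟨g, hg⟩ := hcov v
    have h2 : g • v ∈ F ∩ S := ⟨hg, hS g v hv⟩
    rw [← h1] at h2
    simpa using hS'.2.1 g⁻¹ _ h2.2
  refine ⟨{
    V := S
    graph := Γ.induce S
    nonempty := hne.to_subtype
    connected := hconn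
    acyclic := hΓ.2.induce S
    act := fun g w => ⟨g • (w : V), hS g _ w.2⟩
    act_one := fun w => Subtype.ext (one_smul G (w : V))
    act_mul := fun g h w => Subtype.ext (mul_smul g h (w : V))
    act_adj := fun g a b h => hadj g _ _ h
    noInversion := fun g a b h h' =>
      hinv g _ _ h ⟨congrArg Subtype.val h'.1, congrArg Subtype.val h'.2⟩
    minimal := ?_ }, Subtype.val, fun _ _ => rfl, Subtype.val_injective, fun _ _ h => h⟩
  intro S' hne' hS' hconn'
  have h1 : Subtype.val '' S' ∈ good := by
    refine ⟨hne'.image _, ?_, ?_⟩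
    · rintro g _ ⟨w, hw, rfl⟩
      exact ⟨_, hS' g w hw, rfl⟩
    · let f : (Γ.induce S).induce S' →g Γ.induce (Subtype.val '' S') :=
        ⟨fun w => ⟨w.1.1, w.1, w.2, rfl⟩, fun h => h⟩
      refine hconn'.map f ?_
      rintro ⟨_, w, hw, rfl⟩
      exact ⟨⟨w, hw⟩, rfl⟩
  have h2 := hmin' _ h1 (by rintro _ ⟨w, _, rfl⟩; exact w.2)
  refine Set.eq_univ_of_forall fun w => ?_
  obtain ⟨w', hw', he⟩ := h2.ge w.2
  rwa [← Subtype.ext he]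

end GTree

/-! ### Pairing consecutive elements of finite ordered sets -/

section Rank

open scoped Classical in
/-- The number of elements of `s` which come before `a` in the order defined by `f`. -/
noncomputable def rank {ι : Type*} (s : Finset ι) (f : ι → ℕ) (a : ι) : ℕ :=
  (s.filter fun b => f b < f a).card

variable {ι : Type*} {s t : Finset ι} {f : ι → ℕ}

theorem rank_lt_rank {a b : ι} (ha : a ∈ s) (h : f a < f b) : rank s f a < rank s f b := by
  classical
  refine Finset.card_lt_card ((Finset.ssubset_iff_of_subset fun c hc => ?_).2 ⟨a, ?_, ?_⟩)
  · simp only [Finset.mem_filter] at hc ⊢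
    exact ⟨hc.1, hc.2.trans h⟩
  · simp [ha, h]
  · simp

theorem rank_lt_card {a : ι} (ha : a ∈ s) : rank s f a < s.card := by
  classical
  refine Finset.card_lt_card ((Finset.ssubset_iff_of_subset (Finset.filter_subset _ _)).2
    ⟨a, ha, by simp⟩)

theorem rank_injOn (hf : Set.InjOn f s) : Set.InjOn (rank s f) s := by
  intro a ha b hb h
  by_contra hne
  have : f a ≠ f b := fun h' => hne (hf ha hb h')
  rcases lt_or_gt_of_ne this with h' | h'
  · exact (rank_lt_rank ha h').ne h
  · exact (rank_lt_rank hb h').ne h.symm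

theorem exists_rank_eq (hf : Set.InjOn f s) {i : ℕ} (hi : i < s.card) :
    ∃ a ∈ s, rank s f a = i := by
  classical
  have h : s.image (rank s f) = Finset.range s.card := by
    refine Finset.eq_of_subset_of_card_le (fun j hj => ?_) ?_
    · obtain ⟨a, ha, rfl⟩ := Finset.mem_image.1 hj
      exact Finset.mem_range.2 (rank_lt_card ha)
    · rw [Finset.card_range, Finset.card_image_of_injOn (rank_injOn hf)]
  have : i ∈ s.image (rank s f) := by rw [h]; simpa using hi
  simpa using this

theorem rank_add_rank {f' : ι → ℕ} (hf : Set.InjOn f s)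
    (h : ∀ a ∈ s, ∀ b ∈ s, f a < f b ↔ f' b < f' a) {a : ι} (ha : a ∈ s) :
    rank s f a + rank s f' a + 1 = s.card := by
  classical
  have h1 : s.filter (fun b => f' b < f' a) = (s.filter fun b => ¬f b < f a).erase a := by
    ext b
    simp only [Finset.mem_filter, Finset.mem_erase]
    constructor
    · rintro ⟨hb, hlt⟩
      have := (h a ha b hb).2 hlt
      exact ⟨by rintro rfl; omega, hb, by omega⟩
    · rintro ⟨hne, hb, hlt⟩
      have : f a ≠ f b := fun h' => hne (hf ha hb h').symm
      exact ⟨hb, (h a ha b hb).1 (by omega)⟩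
  have h2 := Finset.card_filter_add_card_filter_not (s := s) (fun b => f b < f a)
  have h3 : a ∈ s.filter fun b => ¬f b < f a := by simp [ha]
  have h4 := Finset.card_erase_add_one h3
  rw [rank, rank, h1]
  omega

theorem rank_eq_of_initial (hts : t ⊆ s) (h : ∀ a ∈ s, ∀ b ∈ t, f a < f b → a ∈ t) {a : ι}
    (ha : a ∈ t) : rank s f a = rank t f a := by
  classical
  rw [rank, rank]
  congr 1
  ext b
  simp only [Finset.mem_filter]
  exact ⟨fun hb => ⟨h b hb.1 a ha hb.2, hb.2⟩, fun hb => ⟨hts hb.1, hb.2⟩⟩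

theorem card_le_rank_of_initial (hf : Set.InjOn f s) (hts : t ⊆ s)
    (h : ∀ a ∈ s, ∀ b ∈ t, f a < f b → a ∈ t) {a : ι} (ha : a ∈ s) (hat : a ∉ t) :
    t.card ≤ rank s f a := by
  classical
  refine Finset.card_le_card fun b hb => ?_
  have h1 : ¬f a < f b := fun h' => hat (h a ha b hb h')
  have h2 : f a ≠ f b := fun h' => hat (hf ha (hts hb) h' ▸ hb)
  simp only [Finset.mem_filter]
  exact ⟨hts hb, by omega⟩

/-- The elements `a` and `b` are the `2i`-th and `2i + 1`-st elements of `s`, in some order. -/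
structure Paired (s : Finset ι) (f : ι → ℕ) (a b : ι) : Prop where
  left_mem : a ∈ s
  right_mem : b ∈ s
  rank_eq : rank s f a / 2 = rank s f b / 2

theorem Paired.symm {a b : ι} (h : Paired s f a b) : Paired s f b a :=
  ⟨h.right_mem, h.left_mem, h.rank_eq.symm⟩

theorem exists_paired (hf : Set.InjOn f s) (hs : Even s.card) {a : ι} (ha : a ∈ s) :
    ∃ b, b ≠ a ∧ Paired s f a b := by
  have h1 := rank_lt_card (f := f) ha
  obtain ⟨m, hm⟩ := hs
  rcases Nat.even_or_odd' (rank s f a) with ⟨c, hc | hc⟩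
  · obtain ⟨b, hb, hr⟩ := exists_rank_eq hf (i := 2 * c + 1) (by omega)
    exact ⟨b, by rintro rfl; omega, ha, hb, by omega⟩
  · obtain ⟨b, hb, hr⟩ := exists_rank_eq hf (i := 2 * c) (by omega)
    exact ⟨b, by rintro rfl; omega, ha, hb, by omega⟩

theorem Paired.flip {f' : ι → ℕ} (hf : Set.InjOn f s) (hs : Even s.card)
    (h : ∀ a ∈ s, ∀ b ∈ s, f a < f b ↔ f' b < f' a) {a b : ι} (hab : Paired s f a b) :
    Paired s f' a b := by
  have h1 := rank_add_rank hf h hab.left_mem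
  have h2 := rank_add_rank hf h hab.right_mem
  have h3 := hab.rank_eq
  obtain ⟨m, hm⟩ := hs
  exact ⟨hab.left_mem, hab.right_mem, by omega⟩

theorem Paired.of_initial (hf : Set.InjOn f s) (hts : t ⊆ s) (ht : Even t.card)
    (h : ∀ a ∈ s, ∀ b ∈ t, f a < f b → a ∈ t) {a b : ι} (hab : Paired s f a b) (ha : a ∈ t) :
    Paired t f a b := by
  have h1 := rank_lt_card (f := f) ha
  have h2 := rank_eq_of_initial hts h ha
  have h3 := hab.rank_eq
  obtain ⟨m, hm⟩ := ht
  have hb : b ∈ t := by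
    by_contra hb
    have := card_le_rank_of_initial hf hts h hab.right_mem hb
    omega
  have h4 := rank_eq_of_initial hts h hb
  exact ⟨ha, hb, by omega⟩

theorem Paired.of_subset (hts : t ⊆ s) (h : ∀ a ∈ s, ∀ b ∈ t, f a < f b → a ∈ t) {a b : ι}
    (hab : Paired t f a b) : Paired s f a b :=
  ⟨hts hab.left_mem, hts hab.right_mem, by
    rw [rank_eq_of_initial hts h hab.left_mem, rank_eq_of_initial hts h hab.right_mem,
      hab.rank_eq]⟩

end Rank

section Conn

variable {G Λ Λ' : Type*} [Group G] {B : Set G} {R : Λ → G → G → Prop} {R' : Λ' → G → G → Prop}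

theorem Conn.congr {l : Λ} {l' : Λ'} (h : ∀ x y, R l x y → R' l' x y) {q q' : G × G}
    (hc : Conn B R (l, q) (l, q')) : Conn B R' (l', q) (l', q') := by
  suffices ∀ p, Conn B R (l, q) p → Conn B R' (l', q) (l', p.2) from this _ hc
  intro p hp
  induction hp with
  | refl => exact .refl _
  | @tail b d hp hpq ih =>
    have h1 : l = b.1 := Conn.fst_eq hp
    have h2 : l = d.1 := h1.trans hpq.fst_eq
    exact ih.trans (Link.conn ⟨rfl, ⟨hpq.left.adj, h _ _ (h1 ▸ hpq.left.rel)⟩,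
      ⟨hpq.right.adj, h _ _ (h2 ▸ hpq.right.rel)⟩, hpq.adj₁₁, hpq.adj₁₂, hpq.adj₂₁, hpq.adj₂₂⟩)

end Conn

namespace GTree

open TreeSep
open scoped Pointwise

variable {G : Type u} [Group G] {T : GTree G} {o : T.V} {B : Set G}

/-- The set of edges of the complex dual to a track. -/
def track (T : GTree G) (o : T.V) (B : Set G) (p : (T.V × T.V) × G × G) : Set (G × G) :=
  {q | Conn B (ERel T o) p (p.1, q)}

/-- The set of all tracks. -/
def walls (T : GTree G) (o : T.V) (B : Set G) : Set (Set (G × G)) :=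
  {D | ∃ p, Valid B (ERel T o) p ∧ D = track T o B p}

theorem track_eq_of_conn (hB : IsCoclosed B) {p q : (T.V × T.V) × G × G}
    (h : Conn B (ERel T o) p q) : track T o B p = track T o B q := by
  ext r
  simp only [track, ← h.fst_eq]
  exact ⟨fun h' => (h.symm hB).trans h', fun h' => h.trans h'⟩

theorem track_eq_of_mem (hB : IsCoclosed B) {p : (T.V × T.V) × G × G} {q : G × G}
    (h : q ∈ track T o B p) : track T o B p = track T o B (p.1, q) := track_eq_of_conn hB h

theorem valid_of_mem_track {p : (T.V × T.V) × G × G} (hp : Valid B (ERel T o) p) {q : G × G}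
    (h : q ∈ track T o B p) : Valid B (ERel T o) (p.1, q) := Conn.valid h hp

theorem track_swap (a b : T.V) (q : G × G) :
    track T o B ((a, b), q) = track T o B ((b, a), q) := by
  ext r
  exact ⟨Conn.congr fun _ _ h => h.swap, Conn.congr fun _ _ h => h.swap⟩

theorem track_congr {p q : (T.V × T.V) × G × G} (h : s(p.1.1, p.1.2) = s(q.1.1, q.1.2))
    (h' : p.2 = q.2) : track T o B p = track T o B q := by
  obtain ⟨⟨a, b⟩, x⟩ := p
  obtain ⟨⟨a', b'⟩, y⟩ := q
  obtain rfl : x = y := h'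
  rcases Sym2.eq_iff.1 h with ⟨h1, h2⟩ | ⟨h1, h2⟩
  · obtain rfl : a = a' := h1
    obtain rfl : b = b' := h2
    rfl
  · obtain rfl : a = b' := h1
    obtain rfl : b = a' := h2
    exact track_swap _ _ _

theorem smul_mem_track {p : (T.V × T.V) × G × G} {q : G × G} (g : G) (h : q ∈ track T o B p) :
    g • q ∈ track T o B (g • p) := Conn.smul ERel.smul g h

theorem smul_track (g : G) (p : (T.V × T.V) × G × G) :
    g • track T o B p = track T o B (g • p) := by
  ext q
  rw [Set.mem_smul_set_iff_inv_smul_mem]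
  constructor
  · intro h
    simpa using smul_mem_track g h
  · intro h
    simpa using smul_mem_track g⁻¹ h

theorem smul_mem_walls {D : Set (G × G)} (hD : D ∈ walls T o B) (g : G) :
    g • D ∈ walls T o B := by
  obtain ⟨p, hp, rfl⟩ := hD
  exact ⟨g • p, hp.smul ERel.smul g, smul_track g p⟩

theorem finite_walls (hB : IsCoclosed B) (q : G × G) : {D ∈ walls T o B | q ∈ D}.Finite := by
  refine ((finite_sep T.connected (q.1 • o) (q.2 • o)).image
    fun e => track T o B (e, q)).subset ?_
  rintro _ ⟨⟨p, hp, rfl⟩, hq⟩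
  exact ⟨p.1, (valid_of_mem_track hp hq).rel.2, (track_eq_of_mem hB hq).symm⟩

theorem swap_mem_walls (hB : IsCoclosed B) {D : Set (G × G)} (hD : D ∈ walls T o B) {x y : G}
    (h : (x, y) ∈ D) : (y, x) ∈ D := by
  obtain ⟨p, hp, rfl⟩ := hD
  have hv := valid_of_mem_track hp h
  refine Conn.trans h (Link.conn ⟨rfl, hv, ⟨hB.symm hv.adj, hv.rel.1, hv.rel.2.symm⟩,
    ?_, ?_, ?_, ?_⟩)
  exacts [hv.adj, hB.refl _, hB.refl _, hB.symm hv.adj]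

theorem mem_walls_cocycle (hB : IsCoclosed B) {D : Set (G × G)} (hD : D ∈ walls T o B)
    {x y z : G} (hxy : BAdj B x y) (hyz : BAdj B y z) (hxz : BAdj B x z) :
    (x, z) ∈ D ↔ Xor ((x, y) ∈ D) ((y, z) ∈ D) := by
  obtain ⟨p, hp, rfl⟩ := hD
  exact conn_cocycle hB hp hxy hyz hxz

/-- A track is connected. -/
theorem walls_induction (hB : IsCoclosed B) {D : Set (G × G)} (hD : D ∈ walls T o B)
    {P : G → G → Prop} (hsymm : ∀ x y, (x, y) ∈ D → P x y → P y x)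
    (hmove : ∀ x y z, BAdj B x y → BAdj B y z → BAdj B x z → (x, y) ∈ D → (x, z) ∈ D →
      P x y → P x z)
    {q : G × G} (hq : q ∈ D) (hP : P q.1 q.2) {q' : G × G} (hq' : q' ∈ D) : P q'.1 q'.2 := by
  have hD' := hD
  obtain ⟨p, hp, rfl⟩ := hD
  rw [track_eq_of_mem hB hq] at hq'
  suffices ∀ r, Conn B (ERel T o) (p.1, q) r → P r.2.1 r.2.2 from this _ hq'
  intro r hr
  induction hr with
  | refl => exact hP
  | @tail r s hr hrs ih =>
    have h1 : p.1 = r.1 := Conn.fst_eq (p := (p.1, q)) hr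
    have h2 : p.1 = s.1 := h1.trans hrs.fst_eq
    have hrD : (r.2.1, r.2.2) ∈ track T o B p := by
      rw [track_eq_of_mem hB hq]
      have e : (p.1, r.2) = r := Prod.ext h1 rfl
      show Conn B _ (p.1, q) (p.1, r.2)
      rw [e]
      exact hr
    have hsD : (s.2.1, s.2.2) ∈ track T o B p := by
      rw [track_eq_of_mem hB hq]
      have e : (p.1, s.2) = s := Prod.ext h2 rfl
      show Conn B _ (p.1, q) (p.1, s.2)
      rw [e]
      exact Conn.trans hr hrs.conn
    obtain ⟨l, x, y⟩ := r
    obtain ⟨l', x', y'⟩ := s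
    have hxy : BAdj B x y := hrs.left.adj
    have hxy' : BAdj B x' y' := hrs.right.adj
    have h11 : BAdj B x x' := hrs.adj₁₁
    have h12 : BAdj B x y' := hrs.adj₁₂
    have h21 : BAdj B y x' := hrs.adj₂₁
    have h22 : BAdj B y y' := hrs.adj₂₂
    simp only at hrD hsD ih ⊢
    by_cases hm : (x, y') ∈ track T o B p
    · have := hsymm _ _ hm (hmove _ _ _ hxy h22 h12 hrD hm ih)
      exact hsymm _ _ (swap_mem_walls hB hD' hsD) (hmove _ _ _ (hB.symm h12) h11 (hB.symm hxy')
        (swap_mem_walls hB hD' hm) (swap_mem_walls hB hD' hsD) this)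
    · have hm' : (y, y') ∈ track T o B p := by
        have := mem_walls_cocycle hB hD' hxy h22 h12
        simp only [Xor] at this
        tauto
      have := hsymm _ _ hm' (hmove _ _ _ (hB.symm hxy) h12 h22 (swap_mem_walls hB hD' hrD) hm'
        (hsymm _ _ hrD ih))
      exact hsymm _ _ (swap_mem_walls hB hD' hsD) (hmove _ _ _ (hB.symm h22) h21 (hB.symm hxy')
        (swap_mem_walls hB hD' hm') (swap_mem_walls hB hD' hsD) this)

theorem badj_of_mem_walls {D : Set (G × G)} (hD : D ∈ walls T o B) {x y : G} (h : (x, y) ∈ D) :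
    BAdj B x y := by
  obtain ⟨p, hp, rfl⟩ := hD
  exact (valid_of_mem_track hp h).adj

/-- A family of tracks meeting all pairs of adjacent edges an even number of times is empty. -/
theorem walls_eq_empty (hB : IsCoclosed B) {F : Set (Set (G × G))} (hF : F ⊆ walls T o B)
    (heven : ∀ x y z, BAdj B x y → BAdj B y z → BAdj B x z →
      Even {D ∈ F | (x, y) ∈ D ∧ (x, z) ∈ D}.ncard) : F = ∅ := by
  classical
  have hfin : ∀ x y, {D ∈ F | (x, y) ∈ D}.Finite := fun x y =>
    (finite_walls hB (x, y)).subset fun D hD => ⟨hF hD.1, hD.2⟩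
  have hrep : ∀ D : Set (G × G), ∃ e : T.V × T.V, D ∈ F → ∃ q, Valid B (ERel T o) (e, q) ∧
      D = track T o B (e, q) := by
    intro D
    by_cases hD : D ∈ F
    · obtain ⟨p, hp, h⟩ := hF hD
      exact ⟨p.1, fun _ => ⟨p.2, hp, h⟩⟩
    · exact ⟨(o, o), fun h => absurd h hD⟩
  choose e he using hrep
  have hval : ∀ D ∈ F, ∀ x y, (x, y) ∈ D → Valid B (ERel T o) (e D, x, y) := by
    intro D hD x y h
    obtain ⟨q, hq, hDq⟩ := he D hD
    rw [hDq] at h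
    exact valid_of_mem_track hq h
  have htrack : ∀ D ∈ F, ∀ x y, (x, y) ∈ D → D = track T o B (e D, x, y) := by
    intro D hD x y h
    obtain ⟨q, hq, hDq⟩ := he D hD
    rw [hDq] at h
    exact hDq.trans (track_eq_of_mem hB h)
  let m : G → G → Finset (Set (G × G)) := fun x y => (hfin x y).toFinset
  have hm : ∀ {x y D}, D ∈ m x y ↔ D ∈ F ∧ (x, y) ∈ D := by
    intro x y D
    simp [m]
  let d : G → Set (G × G) → ℕ := fun x D => depth T.graph (x • o) (e D)
  have hinj : ∀ x y, Set.InjOn (d x) (m x y) := by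
    intro x y D hD D' hD' h
    rw [Finset.mem_coe, hm] at hD hD'
    have h1 := hval D hD.1 x y hD.2
    have h2 := hval D' hD'.1 x y hD'.2
    rw [htrack D hD.1 x y hD.2, htrack D' hD'.1 x y hD'.2]
    exact track_congr (depth_injOn T.isTree h1.rel.1 h2.rel.1 h1.rel.2 h2.rel.2 h) rfl
  have hsymm : ∀ x y, m x y = m y x := by
    intro x y
    ext D
    rw [hm, hm]
    exact ⟨fun h => ⟨h.1, swap_mem_walls hB (hF h.1) h.2⟩,
      fun h => ⟨h.1, swap_mem_walls hB (hF h.1) h.2⟩⟩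
  have hrev : ∀ x y, ∀ D ∈ m x y, ∀ D' ∈ m x y, d x D < d x D' ↔ d y D' < d y D := by
    intro x y D hD D' hD'
    rw [hm] at hD hD'
    have h1 := depth_add_depth T.connected (hval D hD.1 x y hD.2).rel.2
    have h2 := depth_add_depth T.connected (hval D' hD'.1 x y hD'.2).rel.2
    simp only [d]
    simp only at h1 h2
    omega
  have hinit : ∀ x y z, BAdj B x y → BAdj B y z → BAdj B x z → ∀ D ∈ m x y,
      ∀ D' ∈ m x y ∩ m x z, d x D < d x D' → D ∈ m x y ∩ m x z := by
    intro x y z hxy hyz hxz D hD D' hD' hlt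
    rw [Finset.mem_inter, hm, hm] at hD' ⊢
    rw [hm] at hD
    have h1 := hval D hD.1 x y hD.2
    have h2 := hval D' hD'.1.1 x y hD'.1.2
    have h3 := hval D' hD'.1.1 x z hD'.2.2
    have h4 := sep_of_depth_lt T.isTree h1.rel.1 h2.rel.1 h1.rel.2 h2.rel.2 h3.rel.2 hlt
    refine ⟨hD, hD.1, ?_⟩
    rw [htrack D hD.1 x y hD.2]
    exact Link.conn ⟨rfl, h1, ⟨hxz, h1.rel.1, h4⟩, hB.refl x, hxz, hB.symm hxy, hyz⟩
  have hev : ∀ x y z, BAdj B x y → BAdj B y z → BAdj B x z → Even (m x y ∩ m x z).card := by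
    intro x y z h1 h2 h3
    have := heven x y z h1 h2 h3
    rw [← Set.ncard_coe_finset]
    convert this using 2
    ext D
    simp only [Finset.coe_inter, Set.mem_inter_iff, Finset.mem_coe, hm]
    exact ⟨fun h => ⟨h.1.1, h.1.2, h.2.2⟩, fun h => ⟨⟨h.1, h.2.1⟩, h.1, h.2.2⟩⟩
  have hev' : ∀ x y, BAdj B x y → Even (m x y).card := by
    intro x y h
    simpa using hev x y y h (hB.refl y) h
  have hflip : ∀ D D' x y, BAdj B x y → Paired (m x y) (d x) D D' →
      Paired (m y x) (d y) D D' := by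
    intro D D' x y hxy h
    rw [← hsymm x y]
    exact h.flip (hinj x y) (hev' x y hxy) (hrev x y)
  have hmove : ∀ D D' x y z, BAdj B x y → BAdj B y z → BAdj B x z → (x, z) ∈ D →
      Paired (m x y) (d x) D D' → Paired (m x z) (d x) D D' := by
    intro D D' x y z hxy hyz hxz hD h
    have h1 : D ∈ m x y ∩ m x z :=
      Finset.mem_inter.2 ⟨h.left_mem, hm.2 ⟨(hm.1 h.left_mem).1, hD⟩⟩
    have h2 := h.of_initial (hinj x y) Finset.inter_subset_left (hev x y z hxy hyz hxz)
      (hinit x y z hxy hyz hxz) h1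
    refine h2.of_subset Finset.inter_subset_right ?_
    rw [Finset.inter_comm]
    exact hinit x z y hxz (hB.symm hyz) hxy
  have hsub : ∀ D D' x y, Paired (m x y) (d x) D D' → D ⊆ D' := by
    intro D D' x y h q hq
    have hD := hm.1 h.left_mem
    have hW := hF hD.1
    have := walls_induction hB hW (P := fun x y => Paired (m x y) (d x) D D')
      (fun x y hxy h => hflip D D' x y (badj_of_mem_walls hW hxy) h)
      (fun x y z h1 h2 h3 _ h5 h => hmove D D' x y z h1 h2 h3 h5 h) hD.2 h hq
    exact (hm.1 this.right_mem).2
  refine Set.eq_empty_of_forall_notMem fun D hD => ?_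
  obtain ⟨⟨⟨a, b⟩, x, y⟩, hp, hDp⟩ := hF hD
  have hxy : (x, y) ∈ D := by
    rw [hDp]
    exact Conn.refl _
  obtain ⟨D', hne, h⟩ := exists_paired (hinj x y) (hev' x y hp.adj) (hm.2 ⟨hD, hxy⟩)
  exact hne ((hsub D' D x y h.symm).antisymm (hsub D D' x y h))

end GTree

namespace GTree

open TreeSep
open scoped Pointwise

variable {G : Type u} [Group G] {T : GTree G} {o : T.V} {B : Set G}

theorem smul_mem_walls_iff {D : Set (G × G)} {g : G} : g • D ∈ walls T o B ↔ D ∈ walls T o B :=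
  ⟨fun h => by simpa using smul_mem_walls h g⁻¹, fun h => smul_mem_walls h g⟩

/-- The number of orbits of tracks is bounded independently of the tree. -/
theorem card_le_of_subset_walls (hB : IsCoclosed B)
    (s : Finset (MulAction.orbitRel.Quotient G (Set (G × G))))
    (hs : ∀ q ∈ s, ∃ D ∈ walls T o B, Quotient.mk'' D = q) :
    s.card ≤ (hB.finite.toFinset ×ˢ hB.finite.toFinset).card := by
  classical
  by_contra! hlt
  let J := hB.finite.toFinset ×ˢ hB.finite.toFinset
  have hfin : ∀ q q', {D ∈ walls T o B | q ∈ D ∧ q' ∈ D}.Finite := fun q q' =>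
    (finite_walls hB q).subset fun D hD => ⟨hD.1, hD.2.1⟩
  let E : G × G → Finset (Set (G × G)) := fun j => (hfin (1, j.1) (1, j.2)).toFinset
  let cls : Set (G × G) → MulAction.orbitRel.Quotient G (Set (G × G)) := Quotient.mk''
  let ev : Set (G × G) → (s → ZMod 2) →ₗ[ZMod 2] ZMod 2 := fun D =>
    if h : cls D ∈ s then LinearMap.proj ⟨cls D, h⟩ else 0
  let φ : (s → ZMod 2) →ₗ[ZMod 2] (J → ZMod 2) := LinearMap.pi fun j => ∑ D ∈ E j, ev D
  have hker : LinearMap.ker φ ≠ ⊥ := LinearMap.ker_ne_bot_of_finrank_lt (by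
    rw [Module.finrank_pi, Module.finrank_pi, Fintype.card_coe, Fintype.card_coe]
    exact hlt)
  obtain ⟨v, hv, hv0⟩ := Submodule.exists_mem_ne_zero_of_ne_bot hker
  have hcls : ∀ (g : G) D, cls (g • D) = cls D := fun g D =>
    Quotient.sound ((MulAction.orbitRel_apply).2 (MulAction.mem_orbit D g))
  have hev : ∀ (g : G) D, ev (g • D) = ev D := by
    intro g D
    simp only [ev]
    rw [hcls]
  let F : Set (Set (G × G)) := {D ∈ walls T o B | ev D v ≠ 0}
  have hF : F = ∅ := by
    refine walls_eq_empty hB (fun D hD => hD.1) fun x y z hxy _ hxz => ?_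
    have h1 : {D ∈ F | (x, y) ∈ D ∧ (x, z) ∈ D} =
        x • {D ∈ F | (1, x⁻¹ * y) ∈ D ∧ (1, x⁻¹ * z) ∈ D} := by
      ext D
      rw [Set.mem_smul_set_iff_inv_smul_mem]
      simp only [F, Set.mem_ofPred_eq, smul_mem_walls_iff, hev, Set.mem_smul_set_iff_inv_smul_mem,
        inv_inv, Prod.smul_mk, smul_eq_mul, mul_one, mul_inv_cancel_left]
    rw [h1, Set.ncard_smul_set]
    have h2 : {D ∈ F | (1, x⁻¹ * y) ∈ D ∧ (1, x⁻¹ * z) ∈ D} =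
        ((E (x⁻¹ * y, x⁻¹ * z)).filter fun D => ev D v ≠ 0 : Finset _) := by
      ext D
      simp only [F, E, Set.mem_ofPred_eq, Finset.coe_filter, Set.Finite.mem_toFinset]
      tauto
    rw [h2, Set.ncard_coe_finset, ← ZMod.natCast_eq_zero_iff_even, Finset.natCast_card_filter]
    have hj : (x⁻¹ * y, x⁻¹ * z) ∈ J := by
      simp only [J, Finset.mem_product, Set.Finite.mem_toFinset]
      exact ⟨hxy, hxz⟩
    have h3 := congrFun (LinearMap.mem_ker.1 hv) ⟨_, hj⟩
    simp only [φ, LinearMap.pi_apply, LinearMap.sum_apply, Pi.zero_apply] at h3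
    refine (Finset.sum_congr rfl fun D _ => ?_).trans h3
    generalize ev D v = a
    revert a
    decide
  refine hv0 (funext fun ⟨q, hq⟩ => ?_)
  by_contra hne
  obtain ⟨D, hD, rfl⟩ := hs q hq
  have : D ∈ F := by
    refine ⟨hD, ?_⟩
    simp only [ev, cls, dif_pos hq]
    exact hne
  rw [hF] at this
  exact this

/-- An increasing sequence of families of tracks is eventually constant. -/
theorem exists_walls_eq (hB : IsCoclosed B) (T : ℕ → GTree G) (o : ∀ k, (T k).V)
    (hmono : ∀ k, walls (T k) (o k) B ⊆ walls (T (k + 1)) (o (k + 1)) B) :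
    ∃ k₀, ∀ k ≥ k₀, walls (T k) (o k) B = walls (T k₀) (o k₀) B := by
  let W : ℕ → Set (MulAction.orbitRel.Quotient G (Set (G × G))) := fun k =>
    Quotient.mk'' '' walls (T k) (o k) B
  have hm : Monotone fun k => walls (T k) (o k) B := monotone_nat_of_le_succ hmono
  have hcard : ∀ k, ∀ s : Finset (MulAction.orbitRel.Quotient G (Set (G × G))), ↑s ⊆ W k →
      s.card ≤ (hB.finite.toFinset ×ˢ hB.finite.toFinset).card := fun k s hs =>
    card_le_of_subset_walls (T := T k) (o := o k) hB s fun q hq => hs hq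
  have hWfin : ∀ k, (W k).Finite := by
    intro k
    by_contra hinf
    obtain ⟨s, hs, hc⟩ := Set.Infinite.exists_subset_card_eq hinf
      ((hB.finite.toFinset ×ˢ hB.finite.toFinset).card + 1)
    have := hcard k s hs
    omega
  have hWcard : ∀ k, (W k).ncard ≤ (hB.finite.toFinset ×ˢ hB.finite.toFinset).card := by
    intro k
    rw [Set.ncard_eq_toFinset_card _ (hWfin k)]
    exact hcard k _ (by simp)
  have hWmono : Monotone fun k => (W k).ncard := fun k l h =>
    Set.ncard_le_ncard (Set.image_mono (hm h)) (hWfin l)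
  obtain ⟨k₀, hk₀⟩ : ∃ k₀, ∀ k ≥ k₀, (W k).ncard ≤ (W k₀).ncard := by
    have hbdd : BddAbove (Set.range fun k => (W k).ncard) :=
      ⟨_, by rintro _ ⟨k, rfl⟩; exact hWcard k⟩
    obtain ⟨k₀, h⟩ := Nat.sSup_mem (Set.range_nonempty fun k => (W k).ncard) hbdd
    exact ⟨k₀, fun k _ => (le_csSup hbdd ⟨k, rfl⟩).trans h.ge⟩
  refine ⟨k₀, fun k hk => Set.Subset.antisymm (fun D hD => ?_) (hm hk)⟩
  have h1 : W k₀ = W k := Set.eq_of_subset_of_ncard_le (Set.image_mono (hm hk)) (hk₀ k hk) (hWfin k)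
  have h2 : (Quotient.mk'' D : MulAction.orbitRel.Quotient G (Set (G × G))) ∈ W k₀ := by
    rw [h1]
    exact ⟨D, hD, rfl⟩
  obtain ⟨D', hD', h⟩ := h2
  obtain ⟨g, hg⟩ := MulAction.orbitRel_apply.1 (Quotient.exact h)
  rw [← smul_mem_walls_iff (g := g)]
  simp only at hg
  rwa [hg]

end GTree

namespace GTree

open TreeSep

variable {G : Type u} [Group G] {T T' T'' : GTree G}

/-- An equivariant surjection between trees such that all edges of the target come from edges
of the source defining the same splitting of the vertices. -/
structure Collapse (T' T : GTree G) (c : T'.V → T.V) : Prop where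
  map_smul : ∀ (g : G) w, c (g • w) = g • c w
  surjective : Function.Surjective c
  exists_lift : ∀ a b, T.graph.Adj a b → ∃ a' b', T'.graph.Adj a' b' ∧ c a' = a ∧ c b' = b ∧
    ∀ x y, Sep T'.graph a' b' x y ↔ Sep T.graph a b (c x) (c y)

theorem Collapse.id (T : GTree G) : Collapse T T fun w => w :=
  ⟨fun _ _ => rfl, fun w => ⟨w, rfl⟩, fun a b h => ⟨a, b, h, rfl, rfl, fun _ _ => Iff.rfl⟩⟩

theorem Collapse.comp {c : T'.V → T.V} {c' : T''.V → T'.V} (h : Collapse T' T c)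
    (h' : Collapse T'' T' c') : Collapse T'' T fun w => c (c' w) := by
  refine ⟨fun g w => by rw [h'.map_smul, h.map_smul], h.surjective.comp h'.surjective,
    fun a b hab => ?_⟩
  obtain ⟨a', b', hab', rfl, rfl, h1⟩ := h.exists_lift a b hab
  obtain ⟨a'', b'', hab'', rfl, rfl, h2⟩ := h'.exists_lift a' b' hab'
  exact ⟨a'', b'', hab'', rfl, rfl, fun x y => (h2 x y).trans (h1 _ _)⟩

theorem exists_sep {x y : T.V} (h : x ≠ y) :
    ∃ a b, T.graph.Adj a b ∧ Sep T.graph a b x y := by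
  obtain ⟨p, -, -, hp⟩ := exists_walk_sep T.isTree x y
  cases p with
  | nil => exact absurd rfl h
  | @cons _ u _ hxu p => exact ⟨x, u, hxu, hp x u (by simp)⟩

theorem Collapse.convex {c : T'.V → T.V} (h : Collapse T' T c) {v x y : T'.V}
    (hv : OnSeg T'.graph v x y) (hxy : c x = c y) : c v = c x := by
  by_contra hne
  obtain ⟨a, b, hab, hs⟩ := exists_sep (Ne.symm hne)
  obtain ⟨a', b', hab', -, -, h1⟩ := h.exists_lift a b hab
  have h2 := (h1 x y).1 (hv.sep T'.isTree hab' ((h1 x v).2 hs))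
  rw [hxy] at h2
  exact not_sep_self _ _ _ h2

theorem IsCollapseMap.collapse {c : T'.V → T.V} (hc : IsCollapseMap T' T c) :
    Collapse T' T c := by
  obtain ⟨hsmul, hsurj, hadj, hconn⟩ := hc
  refine ⟨hsmul, hsurj, fun a b hab => ?_⟩
  obtain ⟨a₀, ha₀⟩ := hsurj a
  obtain ⟨b₀, hb₀⟩ := hsurj b
  have hfib : ∀ a' b', T'.graph.Adj a' b' → c a' ≠ c b' → ∀ x y, c x = c y →
      (Side T'.graph a' b' x ↔ Side T'.graph a' b' y) := by
    intro a' b' hab' hne x y hxy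
    by_contra hs
    obtain ⟨p⟩ := (hconn (c y)).preconnected ⟨x, hxy⟩ ⟨y, rfl⟩
    obtain ⟨u, w, huw, -, h⟩ := exists_step (fun z => Side T'.graph a' b' z.1) p hs
    have h1 := (sep_iff_of_adj T'.acyclic hab' (SimpleGraph.induce_adj.1 huw)).1 h
    have h2 : c u.1 = c w.1 := (show c u.1 = c y from u.2).trans (show c w.1 = c y from w.2).symm
    rcases Sym2.eq_iff.1 h1 with ⟨h3, h4⟩ | ⟨h3, h4⟩
    · exact hne (by rw [← h3, ← h4, h2])
    · exact hne (by rw [← h3, ← h4, h2])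
  have key : ∃ a' b', T'.graph.Adj a' b' ∧ c a' = a ∧ c b' = b := by
    obtain ⟨p⟩ := T'.connected.preconnected a₀ b₀
    have hs : ¬(Side T.graph a b (c a₀) ↔ Side T.graph a b (c b₀)) := by
      rw [ha₀, hb₀]
      exact sep_self T.acyclic hab
    obtain ⟨u, w, huw, -, h⟩ := exists_step (fun z => Side T.graph a b (c z)) p hs
    have h1 : T.graph.Adj (c u) (c w) := by
      rcases hadj u w huw with h1 | h1
      · exact absurd (by simp only [h1]) h
      · exact h1
    rcases Sym2.eq_iff.1 ((sep_iff_of_adj T.acyclic hab h1).1 h) with ⟨h3, h4⟩ | ⟨h3, h4⟩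
    · exact ⟨u, w, huw, h3, h4⟩
    · exact ⟨w, u, huw.symm, h4, h3⟩
  obtain ⟨a', b', hab', rfl, rfl⟩ := key
  refine ⟨a', b', hab', rfl, rfl, fun x y => not_congr ?_⟩
  refine iff_congr_of_adj (h' := fun z => Side T.graph (c a') (c b') (c z)) T'.connected
    (fun u w huw => ?_) x y
  rw [← not_iff_not]
  change Sep T'.graph a' b' u w ↔ Sep T.graph (c a') (c b') (c u) (c w)
  constructor
  · intro h
    rcases Sym2.eq_iff.1 ((sep_iff_of_adj T'.acyclic hab' huw).1 h) with ⟨rfl, rfl⟩ | ⟨rfl, rfl⟩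
    · exact sep_self T.acyclic hab
    · exact (sep_self T.acyclic hab).symm
  · intro h
    have h1 : T.graph.Adj (c u) (c w) := by
      rcases hadj u w huw with h1 | h1
      · rw [h1] at h
        exact absurd h (not_sep_self _ _ _)
      · exact h1
    have h2 := hfib a' b' hab' hab.ne
    rcases Sym2.eq_iff.1 ((sep_iff_of_adj T.acyclic hab h1).1 h) with ⟨h3, h4⟩ | ⟨h3, h4⟩
    · rw [TreeSep.Sep, h2 _ _ h3, h2 _ _ h4]
      exact sep_self T'.acyclic hab'
    · rw [TreeSep.Sep, h2 _ _ h3, h2 _ _ h4]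
      exact (sep_self T'.acyclic hab').symm

theorem Collapse.walls_subset {c : T'.V → T.V} (h : Collapse T' T c) {o' : T'.V} {B : Set G} :
    walls T (c o') B ⊆ walls T' o' B := by
  rintro D ⟨⟨⟨a, b⟩, q⟩, hp, rfl⟩
  obtain ⟨a', b', hab', rfl, rfl, h1⟩ := h.exists_lift a b hp.rel.1
  have h2 : ∀ x y, ERel T (c o') (c a', c b') x y ↔ ERel T' o' (a', b') x y := by
    intro x y
    simp only [ERel]
    rw [h1, h.map_smul, h.map_smul]
    exact and_congr_left fun _ => ⟨fun _ => hab', fun _ => hp.rel.1⟩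
  refine ⟨((a', b'), q), ⟨hp.adj, (h2 _ _).1 hp.rel⟩, ?_⟩
  ext r
  exact ⟨fun hr => Conn.congr (fun x y => (h2 x y).1) hr,
    fun hr => Conn.congr (fun x y => (h2 x y).2) hr⟩

/-- A group acting on a tree with a bounded orbit fixes a point in any invariant subtree. -/
theorem exists_fixed (K : Subgroup G) {Y : Set T.V} (hY : Y.Nonempty)
    (hK : ∀ κ ∈ K, ∀ w ∈ Y, κ • w ∈ Y)
    (hconv : ∀ v x y, x ∈ Y → y ∈ Y → OnSeg T.graph v x y → v ∈ Y)
    {o : T.V} {N : ℕ} (hN : ∀ κ ∈ K, T.graph.dist o (κ • o) ≤ N) :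
    ∃ w ∈ Y, ∀ κ ∈ K, κ • w = w := by
  classical
  have hex : ∃ n, ∃ w ∈ Y, ∀ κ ∈ K, T.graph.dist w (κ • o) ≤ n := by
    obtain ⟨w, hw⟩ := hY
    refine ⟨T.graph.dist w o + N, w, hw, fun κ hκ => ?_⟩
    have := T.connected.dist_triangle (u := w) (v := o) (w := κ • o)
    have := hN κ hκ
    omega
  let n := Nat.find hex
  let M : Set T.V := {w ∈ Y | ∀ κ ∈ K, T.graph.dist w (κ • o) ≤ n}
  have hM : ∀ w ∈ M, ∀ w' ∈ M, w ≠ w' → T.graph.Adj w w' := by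
    intro w hw w' hw' hne
    by_contra hnadj
    obtain ⟨p, -, -, hp⟩ := exists_walk_sep T.isTree w w'
    cases p with
    | nil => exact hne rfl
    | @cons _ u _ hwu p =>
      have hu : OnSeg T.graph u w w' := (hp w u (by simp)).onSeg_right
      have huw' : u ≠ w' := by
        rintro rfl
        exact hnadj hwu
      have hlt : ∀ κ ∈ K, T.graph.dist u (κ • o) < n := by
        intro κ hκ
        rcases hu.or (κ • o) with h | h
        · have h1 := h.dist_add T.connected
          have h2 := hw.2 κ hκ
          have h3 := T.connected.pos_dist_of_ne hwu.ne
          omega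
        · have h1 := h.symm.dist_add T.connected
          have h2 := hw'.2 κ hκ
          have h3 := T.connected.pos_dist_of_ne huw'.symm
          omega
      have h1 := hlt 1 K.one_mem
      refine Nat.find_min hex (m := n - 1) (by omega) ⟨u, hconv u w w' hw.1 hw'.1 hu,
        fun κ hκ => ?_⟩
      have := hlt κ hκ
      omega
  have hdist : ∀ (g : G) (x y : T.V), T.graph.dist (g • x) (g • y) ≤ T.graph.dist x y := by
    intro g x y
    obtain ⟨p, hp⟩ := T.connected.exists_walk_length_eq_dist x y
    rw [← hp, ← SimpleGraph.Walk.length_map (smulHom T g)]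
    exact SimpleGraph.dist_le _
  have hKM : ∀ κ ∈ K, ∀ w ∈ M, κ • w ∈ M := by
    intro κ hκ w hw
    refine ⟨hK κ hκ w hw.1, fun μ hμ => ?_⟩
    have h1 := hdist κ w ((κ⁻¹ * μ) • o)
    rw [smul_smul, mul_inv_cancel_left] at h1
    exact h1.trans (hw.2 _ (K.mul_mem (K.inv_mem hκ) hμ))
  obtain ⟨w, hwY, hw⟩ := Nat.find_spec hex
  have hwM : w ∈ M := ⟨hwY, hw⟩
  refine ⟨w, hwY, fun κ hκ => ?_⟩
  by_contra hne
  have h1 := hKM κ hκ w hwM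
  have h2 := hKM κ hκ _ h1
  have h01 := hM w hwM _ h1 (Ne.symm hne)
  have h12 := T.adj_smul κ h01
  by_cases h3 : κ • κ • w = w
  · exact T.noInversion κ _ _ h01 ⟨rfl, h3⟩
  · have h02 := hM _ h2 w hwM h3
    have h4 := sep_self T.acyclic h01
    rw [sep_trans_iff (y := κ • κ • w), sep_iff_of_adj T.acyclic h01 h02.symm,
      sep_iff_of_adj T.acyclic h01 h12.symm] at h4
    have h5 : s(w, κ • κ • w) ≠ s(w, κ • w) := by
      intro h
      rcases Sym2.eq_iff.1 h with ⟨_, h⟩ | ⟨h, _⟩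
      · exact h12.ne h.symm
      · exact h01.ne h
    have h6 : s(κ • κ • w, κ • w) ≠ s(w, κ • w) := by
      intro h
      rcases Sym2.eq_iff.1 h with ⟨h, _⟩ | ⟨h, _⟩
      · exact h3 h
      · exact h12.ne h.symm
    simp [Xor, h5, h6] at h4

end GTree

namespace GTree

open TreeSep

variable {G : Type u} [Group G] {T T' : GTree G} {o : T.V} {o' : T'.V} {B : Set G}
  {hB : IsCoclosed B}

open scoped Classical in
/-- The track of an edge of the resolution. -/
noncomputable def edgeTrack (e : Sym2 (ResV T o hB)) : Set (G × G) :=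
  if h : ∃ p : (T.V × T.V) × G × G, ∃ P Q : ResV T o hB, e = s(P, Q) ∧ IsResEdge P Q p then
    track T o B h.choose
  else ∅

theorem IsResEdge.edgeTrack_eq {P Q : ResV T o hB} {p : (T.V × T.V) × G × G}
    (h : IsResEdge P Q p) : edgeTrack s(P, Q) = track T o B p := by
  have hex : ∃ p : (T.V × T.V) × G × G, ∃ P' Q' : ResV T o hB,
      s(P, Q) = s(P', Q') ∧ IsResEdge P' Q' p := ⟨p, P, Q, rfl, h⟩
  rw [edgeTrack, dif_pos hex]
  obtain ⟨P', Q', he, hpq⟩ := hex.choose_spec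
  rcases Sym2.eq_iff.1 he with ⟨rfl, rfl⟩ | ⟨rfl, rfl⟩
  · exact track_eq_of_conn hB (hpq.conn h)
  · refine (track_eq_of_conn hB (hpq.conn h.swap)).trans ?_
    exact (track_swap _ _ _).symm

/-- The projection of the resolution to the tree. -/
def resProjHom (T : GTree G) (o : T.V) (hB : IsCoclosed B) : resGraph T o hB →g T.graph where
  toFun := resProj
  map_rel' h := resGraph_adj_proj _ _ h

/-- The action of a group element on the resolution. -/
def resSmulHom (T : GTree G) (o : T.V) (hB : IsCoclosed B) (g : G) :
    resGraph T o hB →g resGraph T o hB where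
  toFun P := g • P
  map_rel' h := resGraph_adj_smul g _ _ h

/-- If all tracks of `T'` are tracks of `T`, the tracks of the edges separating two base points
in the resolution of `T'` are tracks of edges separating them in the resolution of `T`. -/
theorem edgeTrack_mem (hw : walls T' o' B ⊆ walls T o B) {x y : G}
    (W : (resGraph T o hB).Walk (resBase T o hB x) (resBase T o hB y)) {P Q : ResV T' o' hB}
    (hPQ : (resGraph T' o' hB).Adj P Q)
    (hs : Sep (resGraph T' o' hB) P Q (resBase T' o' hB x) (resBase T' o' hB y)) :
    ∃ e ∈ W.edges, edgeTrack e = edgeTrack s(P, Q) := by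
  obtain ⟨q, hq⟩ := hPQ
  rw [hq.edgeTrack_eq]
  obtain ⟨p, hp, hpq⟩ := hw ⟨q, hq.valid, rfl⟩
  have hiff : ∀ r, Conn B (ERel T o) p (p.1, r) ↔ Conn B (ERel T' o') q (q.1, r) := fun r =>
    (Set.ext_iff.1 hpq r).symm
  obtain ⟨A, hA⟩ := exists_conn_primitive hB hp
  obtain ⟨σ', hσ', hedge'⟩ := exists_side hB hq.valid (A := A)
    fun x y h => (hiff (x, y)).symm.trans (hA x y h)
  obtain ⟨σ, hσ, hedge⟩ := exists_side hB hp hA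
  have h1 : ¬(σ' (resBase T' o' hB x) ↔ σ' (resBase T' o' hB y)) := by
    refine fun h => hs ((iff_congr_of_adj resGraph_connected (fun u w huw => ?_) _ _).2 h)
    obtain ⟨r, hr⟩ := huw
    rw [← not_iff_not, hedge' u w r hr]
    change Sep _ P Q u w ↔ _
    rw [sep_iff_of_adj resGraph_isAcyclic ⟨q, hq⟩ ⟨r, hr⟩]
    constructor
    · intro h
      rcases Sym2.eq_iff.1 h with ⟨rfl, rfl⟩ | ⟨rfl, rfl⟩
      · have h2 := hq.conn hr
        have h3 := h2.fst_eq
        rw [h3]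
        exact ⟨h2, rfl⟩
      · have h2 := hq.conn hr.swap
        have h3 := h2.fst_eq
        rw [h3]
        exact ⟨h2, Sym2.eq_swap⟩
    · rintro ⟨h2, h3⟩
      rcases Sym2.eq_iff.1 h3 with ⟨h4, h5⟩ | ⟨h4, h5⟩
      · have h6 : (q.1, r.2) = r := Prod.ext (Prod.ext h4.symm h5.symm) rfl
        rw [h6] at h2
        obtain ⟨rfl, rfl⟩ := (hq.of_conn h2).eq_and_eq hr
        rfl
      · have h6 : (q.1, r.2) = (r.1.swap, r.2) := Prod.ext (Prod.ext h5.symm h4.symm) rfl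
        rw [h6] at h2
        obtain ⟨rfl, rfl⟩ := (hq.of_conn h2).eq_and_eq hr.swap
        exact Sym2.eq_swap
  rw [hσ', hσ', ← hσ, ← hσ] at h1
  obtain ⟨u, w, huw, he, h⟩ := exists_step σ W h1
  obtain ⟨r, hr⟩ := huw
  refine ⟨_, he, ?_⟩
  obtain ⟨h2, h3⟩ := (hedge u w r hr).1 h
  rw [hr.edgeTrack_eq, hpq, track_eq_of_mem hB (show r.2 ∈ track T o B p from h2)]
  exact track_congr h3 rfl

/-- The number of edges of the resolution with a given track, among finitely many edges, is at
most the distance of two points separated by the track. -/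
theorem card_edgeTrack_le {s : Finset (Sym2 (ResV T o hB))}
    (hs : ∀ e ∈ s, e ∈ (resGraph T o hB).edgeSet) {x y : G}
    (hxy : ∀ e ∈ s, (x, y) ∈ edgeTrack e) : s.card ≤ T.graph.dist (x • o) (y • o) := by
  classical
  obtain ⟨p, hp⟩ := T.connected.exists_walk_length_eq_dist (x • o) (y • o)
  have key : ∀ e ∈ s, ∃ q : T.V × T.V, ∃ P Q : ResV T o hB, e = s(P, Q) ∧
      IsResEdge P Q (q, x, y) := by
    intro e he
    have h1 := hxy e he
    have h2 := hs e he
    induction e using Sym2.ind with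
    | _ P Q =>
      obtain ⟨q, hq⟩ := (SimpleGraph.mem_edgeSet _).1 h2
      rw [hq.edgeTrack_eq] at h1
      exact ⟨q.1, P, Q, rfl, hq.of_conn h1⟩
  have h1 : s.card ≤ p.edges.toFinset.card := by
    refine Finset.card_le_card_of_injOn (Sym2.map resProj) (fun e he => ?_) fun e he e' he' h => ?_
    · obtain ⟨q, P, Q, rfl, hq⟩ := key e he
      rw [Finset.mem_coe, List.mem_toFinset, Sym2.map_mk, hq.proj_left, hq.proj_right]
      exact hq.valid.rel.2.mem_edges p
    · obtain ⟨q, P, Q, rfl, hq⟩ := key e he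
      obtain ⟨q', P', Q', rfl, hq'⟩ := key e' he'
      rw [Sym2.map_mk, Sym2.map_mk, hq.proj_left, hq.proj_right, hq'.proj_left,
        hq'.proj_right] at h
      rcases Sym2.eq_iff.1 h with ⟨h4, h5⟩ | ⟨h4, h5⟩
      · have h6 : q = q' := Prod.ext h4 h5
        subst h6
        obtain ⟨rfl, rfl⟩ := hq.eq_and_eq hq'
        rfl
      · have h6 : q = q'.swap := Prod.ext h4 h5
        subst h6
        obtain ⟨rfl, rfl⟩ := hq.eq_and_eq hq'.swap
        exact Sym2.eq_swap
  exact h1.trans ((List.toFinset_card_le _).trans (by rw [SimpleGraph.Walk.length_edges, hp]))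

/-- Distances in `T'` are bounded in terms of distances in the resolution of `T`. -/
theorem exists_dist_le (hB : IsCoclosed B) (hw : walls T' o' B ⊆ walls T o B) :
    ∃ M, ∀ x y, ∀ W : (resGraph T o hB).Walk (resBase T o hB x) (resBase T o hB y),
      T'.graph.dist (x • o') (y • o') ≤ M * W.length := by
  classical
  refine ⟨hB.finite.toFinset.sup fun b => T'.graph.dist o' (b • o'), fun x y W => ?_⟩
  set M := hB.finite.toFinset.sup fun b => T'.graph.dist o' (b • o') with hMdef
  have hM : ∀ x y, BAdj B x y → T'.graph.dist (x • o') (y • o') ≤ M := by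
    intro x y h
    have h1 : T'.graph.dist o' ((x⁻¹ * y) • o') ≤ M :=
      Finset.le_sup (f := fun b => T'.graph.dist o' (b • o')) (hB.finite.mem_toFinset.2 h)
    obtain ⟨p, hp⟩ := T'.connected.exists_walk_length_eq_dist o' ((x⁻¹ * y) • o')
    rw [← hp, ← SimpleGraph.Walk.length_map (smulHom T' x)] at h1
    have h2 := (SimpleGraph.dist_le (p.map (smulHom T' x))).trans h1
    change T'.graph.dist (x • o') (x • (x⁻¹ * y) • o') ≤ M at h2
    rwa [smul_smul, mul_inv_cancel_left] at h2
  obtain ⟨p, -, hnd, hsep⟩ := exists_walk_sep (resGraph_isTree (T := T') (o := o') (hB := hB))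
    (resBase T' o' hB x) (resBase T' o' hB y)
  have h1 : T'.graph.dist (x • o') (y • o') ≤ p.length := by
    have := SimpleGraph.dist_le (p.map (resProjHom T' o' hB))
    rw [SimpleGraph.Walk.length_map] at this
    change T'.graph.dist (resProj (resBase T' o' hB x)) (resProj (resBase T' o' hB y)) ≤ _ at this
    rwa [resProj_resBase, resProj_resBase] at this
  refine h1.trans ?_
  rw [← SimpleGraph.Walk.length_edges, ← List.toFinset_card_of_nodup hnd]
  have h2 : p.edges.toFinset.card ≤ M * (W.edges.toFinset.image edgeTrack).card := by
    refine Finset.card_le_mul_card_image_of_maps_to (f := edgeTrack) (fun e he => ?_) M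
      fun D hD => ?_
    · rw [List.mem_toFinset] at he
      have he' := p.edges_subset_edgeSet he
      induction e using Sym2.ind with
      | _ P Q =>
        obtain ⟨e, he, h⟩ := edgeTrack_mem hw W ((SimpleGraph.mem_edgeSet _).1 he') (hsep P Q he)
        rw [← h]
        exact Finset.mem_image_of_mem _ (List.mem_toFinset.2 he)
    · rcases (p.edges.toFinset.filter fun e => edgeTrack e = D).eq_empty_or_nonempty with
        h | ⟨e, he⟩
      · rw [h]
        simp
      · have hmem : ∀ e ∈ p.edges.toFinset.filter fun e => edgeTrack e = D,
            e ∈ (resGraph T' o' hB).edgeSet := by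
          intro e he
          exact p.edges_subset_edgeSet (List.mem_toFinset.1 (Finset.mem_filter.1 he).1)
        have h3 : ∃ x y, BAdj B x y ∧ (x, y) ∈ D := by
          have h4 := hmem e he
          rw [← (Finset.mem_filter.1 he).2]
          clear he
          induction e using Sym2.ind with
          | _ P Q =>
            obtain ⟨q, hq⟩ := (SimpleGraph.mem_edgeSet _).1 h4
            rw [hq.edgeTrack_eq]
            exact ⟨q.2.1, q.2.2, hq.valid.adj, Conn.refl _⟩
        obtain ⟨x, y, hxy, hD'⟩ := h3
        refine (card_edgeTrack_le hmem (x := x) (y := y) fun e he => ?_).trans (hM x y hxy)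
        rwa [(Finset.mem_filter.1 he).2]
  refine h2.trans (Nat.mul_le_mul_left M ?_)
  refine Finset.card_image_le.trans ((List.toFinset_card_le _).trans ?_)
  rw [SimpleGraph.Walk.length_edges]

/-- Vertex stabilizers of the resolution of `T` are elliptic in `T'` if `T` is a collapse of `T'`
with the same tracks. -/
theorem Collapse.exists_fixed {c : T'.V → T.V} (h : Collapse T' T c) (hB : IsCoclosed B)
    (ho : c o' = o) (hw : walls T' o' B ⊆ walls T o B) (P : ResV T o hB) :
    ∃ w, c w = resProj P ∧ ∀ κ ∈ MulAction.stabilizer G P, κ • w = w := by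
  subst ho
  obtain ⟨M, hM⟩ := exists_dist_le hB hw
  obtain ⟨W⟩ := (resGraph_connected (T := T) (o := c o') (hB := hB)).preconnected
    (resBase T (c o') hB 1) P
  obtain ⟨w, hw, hfix⟩ := GTree.exists_fixed (MulAction.stabilizer G P)
    (Y := {w | c w = resProj P}) (h.surjective _)
    (fun κ hκ w hw => by
      show c (κ • w) = resProj P
      rw [h.map_smul, show c w = resProj P from hw, ← resProj_smul,
        MulAction.mem_stabilizer_iff.1 hκ])
    (fun v x y hx hy hv => (h.convex hv ((show c x = resProj P from hx).trans
      (show c y = resProj P from hy).symm)).trans hx)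
    (o := o') (N := M * (W.length + W.length)) (fun κ hκ => by
      have h1 : resSmulHom T (c o') hB κ P = P := MulAction.mem_stabilizer_iff.1 hκ
      have h2 : resSmulHom T (c o') hB κ (resBase T (c o') hB 1) = resBase T (c o') hB κ := by
        show κ • resBase T (c o') hB 1 = _
        rw [smul_resBase, mul_one]
      have := hM 1 κ (W.append ((W.map (resSmulHom T (c o') hB κ)).copy h2 h1).reverse)
      rwa [one_smul, SimpleGraph.Walk.length_append, SimpleGraph.Walk.length_reverse,
        SimpleGraph.Walk.length_copy, SimpleGraph.Walk.length_map] at this)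
  exact ⟨w, hw, hfix⟩

end GTree

/-- An equivariant map can be constructed pointwise provided that stabilizers are respected. -/
theorem exists_equivariant {G X Y : Type*} [Group G] [MulAction G X] [MulAction G Y]
    {P : X → Y → Prop} (hP : ∀ (g : G) x y, P x y → P (g • x) (g • y))
    (h : ∀ x, ∃ y, P x y ∧ ∀ g : G, g • x = x → g • y = y) :
    ∃ f : X → Y, (∀ (g : G) x, f (g • x) = g • f x) ∧ ∀ x, P x (f x) := by
  choose φ hφ hfix using h
  let r : X → X := fun x => (Quotient.mk'' x : MulAction.orbitRel.Quotient G X).out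
  have hr : ∀ x, ∃ g : G, g • r x = x := fun x =>
    MulAction.mem_orbit_iff.1 (MulAction.orbitRel_apply.1
      (Quotient.exact (Quotient.out_eq (Quotient.mk'' x : MulAction.orbitRel.Quotient G X)).symm))
  have hrs : ∀ (g : G) x, r (g • x) = r x := fun g x =>
    congrArg Quotient.out (Quotient.sound (MulAction.orbitRel_apply.2 (MulAction.mem_orbit x g)) :
      (Quotient.mk'' (g • x) : MulAction.orbitRel.Quotient G X) = Quotient.mk'' x)
  choose γ hγ using hr
  refine ⟨fun x => γ x • φ (r x), fun g x => ?_, fun x => ?_⟩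
  · have h1 := hfix (r x) ((γ x)⁻¹ * g⁻¹ * γ (g • x)) (by
      have h2 := hγ (g • x)
      rw [hrs] at h2
      rw [mul_smul, h2, mul_smul, inv_smul_smul, inv_smul_eq_iff, hγ])
    simp only [hrs]
    rw [mul_smul, mul_smul, inv_smul_eq_iff, inv_smul_eq_iff] at h1
    exact h1
  · have := hP (γ x) _ _ (hφ (r x))
    rwa [hγ] at this

namespace GTree

variable {G : Type u} [Group G]

/-- The trees in a sequence of collapses collapse to the earlier ones. -/
theorem exists_collapse (T : ℕ → GTree G) (c : ∀ k, (T (k + 1)).V → (T k).V)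
    (hc : ∀ k, Collapse (T (k + 1)) (T k) (c k)) (o : ∀ k, (T k).V)
    (ho : ∀ k, c k (o (k + 1)) = o k) {k₀ k : ℕ} (hk : k₀ ≤ k) :
    ∃ C : (T k).V → (T k₀).V, Collapse (T k) (T k₀) C ∧ C (o k) = o k₀ := by
  induction k, hk using Nat.le_induction with
  | base => exact ⟨_, Collapse.id _, rfl⟩
  | succ k hk ih =>
    obtain ⟨C, hC, hCo⟩ := ih
    exact ⟨_, hC.comp (hc k), by rw [ho, hCo]⟩

theorem exists_basepoints (T : ℕ → GTree G) (c : ∀ k, (T (k + 1)).V → (T k).V)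
    (hc : ∀ k, Collapse (T (k + 1)) (T k) (c k)) :
    ∃ o : ∀ k, (T k).V, ∀ k, c k (o (k + 1)) = o k := by
  choose s hs using fun k => (hc k).surjective
  exact ⟨fun k => Nat.rec (T 0).nonempty.some (fun k w => s k w) k, fun k => hs k _⟩

end GTree

/-- Dunwoody's accessibility for a sequence of refinements. -/
theorem dunwoody_accessibility {G : Type u} [Group G] (hfp : FinitelyPresentedGroup G)
    (𝒜 : Set (Subgroup G)) (h𝒜 : ClosedFamily 𝒜)
    (T : ℕ → GTree G) (hT : ∀ k : ℕ, (T k).IsATree 𝒜)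
    (c : ∀ k : ℕ, (T (k + 1)).V → (T k).V)
    (hc : ∀ k : ℕ, GTree.IsCollapseMap (T (k + 1)) (T k) (c k)) :
    ∃ S : GTree G, S.IsATree 𝒜 ∧
      (∀ a b : S.V, S.graph.Adj a b → (S.edgeStab a b).FG) ∧
      (∀ w : S.V, (S.vertexStab w).FG) ∧
      ∃ k₀ : ℕ, ∀ k ≥ k₀,
        (∃ f : S.V → (T k).V,
          (∀ g w, f (S.act g w) = (T k).act g (f w)) ∧
          ∀ a b : S.V, S.graph.Adj a b → f a ≠ f b) ∧
        S.Dominates (T k) := by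
  obtain ⟨B, hB⟩ := exists_isCoclosed hfp
  have hcol := fun k => (hc k).collapse
  obtain ⟨o, ho⟩ := GTree.exists_basepoints T c hcol
  obtain ⟨k₀, hk₀⟩ := GTree.exists_walls_eq hB T o fun k => by
    have := (hcol k).walls_subset (o' := o (k + 1)) (B := B)
    rwa [ho] at this
  obtain ⟨F, hF, hcov⟩ := GTree.exists_finite_resV (T k₀) (o k₀) hB
  obtain ⟨S, ι, hι, hinj, hadj⟩ := GTree.exists_minimal_subtree GTree.resGraph_isTree
    GTree.resGraph_adj_smul GTree.resGraph_noInversion hF hcov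
  have hstab : ∀ w, S.vertexStab w = MulAction.stabilizer G (ι w) := by
    intro w
    ext g
    rw [MulAction.mem_stabilizer_iff, ← hι, hinj.eq_iff]
    rfl
  refine ⟨S, fun a b hab => ?_, fun a b hab => ?_, fun w => ?_, k₀, fun k hk => ?_⟩
  · refine h𝒜.2 _ (hT k₀ _ _ (GTree.resGraph_adj_proj _ _ (hadj a b hab))) _ ?_
    rw [GTree.edgeStab, hstab, hstab]
    rintro g ⟨h1, h2⟩
    constructor
    · show g • GTree.resProj (ι a) = GTree.resProj (ι a)
      rw [← GTree.resProj_smul, MulAction.mem_stabilizer_iff.1 h1]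
    · show g • GTree.resProj (ι b) = GTree.resProj (ι b)
      rw [← GTree.resProj_smul, MulAction.mem_stabilizer_iff.1 h2]
  · rw [GTree.edgeStab, hstab, hstab]
    exact GTree.resV_edge_stabilizer_fg _ _ (hadj a b hab)
  · rw [hstab]
    exact GTree.resV_stabilizer_fg _
  · obtain ⟨C, hC, hCo⟩ := GTree.exists_collapse T c hcol o ho hk
    obtain ⟨f, hf, hfC⟩ := exists_equivariant (G := G) (X := S.V) (Y := (T k).V)
      (P := fun s w => C w = GTree.resProj (ι s))
      (fun g s w h => by rw [hC.map_smul, h, hι, GTree.resProj_smul])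
      (fun s => by
        obtain ⟨w, hw, hfix⟩ := hC.exists_fixed hB hCo (hk₀ k hk).subset (ι s)
        refine ⟨w, hw, fun g hg => hfix g ?_⟩
        rw [MulAction.mem_stabilizer_iff, ← hι, hg])
    refine ⟨⟨f, hf, fun a b hab h => ?_⟩, fun H ⟨w, hw⟩ => ⟨f w, fun h hh => ?_⟩⟩
    · have h1 := GTree.resGraph_adj_proj _ _ (hadj a b hab)
      rw [← hfC, ← hfC, h] at h1
      exact h1.ne rfl
    · exact (hf h w).symm.trans (congrArg f (hw h hh))
end
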